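/- arXiv:1910.05193 — 6 statements merged into one kernel-verified Lean document; each statement's English description precedes it below -/
import Mathlib

section
/- Let G = (V,E) be a finite simple connected graph and let V1 be a subset of V with at least two elements. Then the intersection of the symmetric edge polytope P_G with the coordinate subspace {x ∈ ℝ^V : x_v = 0 for all v ∉ V1} equals the Kantorovich–Rubinstein polytope K_{G,V1} := conv{ (e_i − e_j)/d(i,j) : i, j ∈ V1, i ≠ j }, where d(i,j) denotes the shortest-path (graph) distance between i and j in G. -/
open SimpleGraph

/-- The symmetric edge polytope of a graph `G`, the convex hull of the points
`e_v - e_w` for all edges `{v, w}` of `G` (both orientations). -/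
def symEdgePolytope {V : Type*} [DecidableEq V] (G : SimpleGraph V) : Set (V → ℝ) :=
  convexHull ℝ {x | ∃ v w, G.Adj v w ∧ x = Pi.single v (1 : ℝ) - Pi.single w 1}

theorem aux_fin {V : Type*} [Fintype V] (S : Set (V → ℝ)) (T : V → V → V → ℝ)
    (h : ∀ x ∈ S, ∃ i j, x = T i j) : S.Finite := by
  apply (Set.finite_range (fun p : V × V => T p.1 p.2)).subset
  intro x hx
  obtain ⟨i, j, rfl⟩ := h x hx
  exact ⟨(i, j), rfl⟩

theorem aux_walk {V : Type*} (G : SimpleGraph V) (F : V → ℝ) (u : ℝ)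
    (h : ∀ v w, G.Adj v w → F v - F w ≤ u) {i j : V} (p : G.Walk i j) :
    F i - F j ≤ u * p.length := by
  induction p with
  | nil => simp
  | cons hadj p ih =>
    have := h _ _ hadj
    rw [SimpleGraph.Walk.length_cons]
    push_cast
    linarith

theorem aux_sep {V : Type*} [Fintype V] (S : Set (V → ℝ)) (hS : S.Finite) (x : V → ℝ)
    (h : x ∉ convexHull ℝ S) : ∃ (f : (V → ℝ) →ₗ[ℝ] ℝ) (u : ℝ), (∀ a ∈ S, f a < u) ∧ u < f x := by
  obtain ⟨f, u, h1, h2⟩ := geometric_hahn_banach_closed_point (convex_convexHull ℝ S)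
    (hS.isClosed_convexHull ℝ) h
  exact ⟨f.toLinearMap, u, fun a ha => h1 a (subset_convexHull ℝ S ha), h2⟩

theorem aux_ext {V : Type*} [Fintype V] (G : SimpleGraph V) (hG : G.Connected) (V1 : Set V)
    (hne : V1.Nonempty) (F : V → ℝ) (u : ℝ) (hu : 0 ≤ u)
    (h : ∀ i ∈ V1, ∀ j ∈ V1, F i - F j ≤ u * G.dist i j) :
    ∃ g : V → ℝ, (∀ i ∈ V1, g i = F i) ∧ ∀ v w, G.Adj v w → g v - g w ≤ u := by
  classical
  haveI : Nonempty V1 := hne.to_subtype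
  have bdd : ∀ v, BddBelow (Set.range fun i : V1 => F i + u * G.dist v i) :=
    fun v => (Set.finite_range _).bddBelow
  refine ⟨fun v => ⨅ i : V1, (F i + u * G.dist v i), ?_, ?_⟩
  · intro i hi
    apply le_antisymm
    · refine (ciInf_le (bdd i) ⟨i, hi⟩).trans ?_
      simp
    · apply le_ciInf
      intro j
      have := h i hi j j.2
      linarith
  · intro v w hvw
    have : (⨅ i : V1, (F i + u * G.dist v i)) - u ≤ ⨅ i : V1, (F i + u * G.dist w i) := by
      apply le_ciInf
      intro j
      have h1 := ciInf_le (bdd v) j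
      have h2 : G.dist v j ≤ G.dist v w + G.dist w j := hG.dist_triangle
      rw [SimpleGraph.dist_eq_one_iff_adj.mpr hvw] at h2
      have h3 : (G.dist v j : ℝ) ≤ 1 + G.dist w j := by exact_mod_cast h2
      have h4 := mul_le_mul_of_nonneg_left h3 hu
      linarith
    simp only
    linarith

/-- For a finite simple connected graph `G` and a subset `V1` of the
vertices with at least two elements, the intersection of the symmetric edge polytope
with the coordinate subspace `{x : x_v = 0 for v ∉ V1}` equals the
Kantorovich–Rubinstein polytope `conv{(e_i - e_j)/d(i,j) : i ≠ j ∈ V1}`. -/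
theorem stmt0 {V : Type*} [Fintype V] [DecidableEq V] (G : SimpleGraph V)
    (hG : G.Connected) (V1 : Set V) (hV1 : 2 ≤ V1.ncard) :
    symEdgePolytope G ∩ {x : V → ℝ | ∀ v ∉ V1, x v = 0} =
      convexHull ℝ {x : V → ℝ | ∃ i ∈ V1, ∃ j ∈ V1, i ≠ j ∧
        x = ((G.dist i j : ℝ))⁻¹ • (Pi.single i (1 : ℝ) - Pi.single j 1)} := by
  have hpos : ∀ i j, i ≠ j → (0 : ℝ) < G.dist i j := fun i j hij => by
    exact_mod_cast hG.pos_dist_of_ne hij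
  apply Set.Subset.antisymm
  · rintro x ⟨hxP, hx0⟩
    by_contra hx
    obtain ⟨f, u, h1, h2⟩ := aux_sep _ (aux_fin _ (fun i j =>
      ((G.dist i j : ℝ))⁻¹ • (Pi.single i (1 : ℝ) - Pi.single j 1))
      (by rintro x ⟨i, -, j, -, -, rfl⟩; exact ⟨i, j, rfl⟩)) x hx
    have h3 : ∀ i ∈ V1, ∀ j ∈ V1, i ≠ j →
        f (Pi.single i 1) - f (Pi.single j 1) < u * G.dist i j := by
      intro i hi j hj hij
      have := h1 _ ⟨i, hi, j, hj, hij, rfl⟩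
      rw [map_smul, map_sub, smul_eq_mul, inv_mul_lt_iff₀ (hpos i j hij)] at this
      linarith
    obtain ⟨a, ha, b, hb, hab⟩ := (Set.one_lt_ncard (Set.toFinite V1)).mp hV1
    have hu : 0 ≤ u := by
      have e1 := h3 a ha b hb hab
      have e2 := h3 b hb a ha hab.symm
      rw [SimpleGraph.dist_comm] at e2
      have := hpos a b hab
      by_contra hneg
      nlinarith
    obtain ⟨g, hg1, hg2⟩ := aux_ext G hG V1 ⟨a, ha⟩ (fun i => f (Pi.single i 1)) u hu (by
      intro i hi j hj
      by_cases hij : i = j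
      · subst hij; simp
      · exact (h3 i hi j hj hij).le)
    have hfx : f x = ∑ v, x v * g v := by
      rw [LinearMap.pi_apply_eq_sum_univ f x]
      apply Finset.sum_congr rfl
      intro v _
      by_cases hv : v ∈ V1
      · rw [hg1 v hv, smul_eq_mul]
        congr 2
        ext k
        simp [Pi.single_apply, eq_comm]
      · simp [hx0 v hv]
    have hconv : Convex ℝ {y : V → ℝ | ∑ v, y v * g v ≤ u} := by
      apply convex_halfSpace_le
      constructor
      · intro y z
        simp [add_mul, Finset.sum_add_distrib]
      · intro c y
        simp [Finset.mul_sum, mul_assoc]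
    have hle : x ∈ {y : V → ℝ | ∑ v, y v * g v ≤ u} := by
      refine convexHull_min ?_ hconv hxP
      rintro y ⟨v, w, hvw, rfl⟩
      have := hg2 v w hvw
      simpa [sub_mul, Finset.sum_sub_distrib, Pi.single_apply] using this
    have hle' : ∑ v, x v * g v ≤ u := hle
    linarith
  · apply convexHull_min
    · rintro x ⟨i, hi, j, hj, hij, rfl⟩
      refine ⟨?_, ?_⟩
      · by_contra hx
        obtain ⟨f, u, h1, h2⟩ := aux_sep _ (aux_fin _ (fun i j =>
          (Pi.single i (1 : ℝ) - Pi.single j 1))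
          (by rintro x ⟨i, j, -, rfl⟩; exact ⟨i, j, rfl⟩)) _ hx
        obtain ⟨p, hp⟩ := hG.exists_walk_length_eq_dist i j
        have := aux_walk G (fun i => f (Pi.single i 1)) u (by
          intro v w hvw
          have := h1 _ ⟨v, w, hvw, rfl⟩
          rw [map_sub] at this
          exact this.le) p
        rw [hp] at this
        rw [map_smul, map_sub, smul_eq_mul, lt_inv_mul_iff₀ (hpos i j hij)] at h2
        linarith
      · intro v hv
        have h1 : v ≠ i := fun h => hv (h ▸ hi)
        have h2 : v ≠ j := fun h => hv (h ▸ hj)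
        simp [Pi.single_apply, h1, h2]
    · apply (convex_convexHull ℝ _).inter
      intro x hx y hy a b _ _ _ v hv
      simp [hx v hv, hy v hv]
end

section
/- Let k ≥ 2 and let C_{2k} be the cycle graph on vertex set ℤ/2kℤ with edges {i, i+1}. Then the Ehrhart counting function of the symmetric edge polytope P_{C_{2k}} ⊆ ℝ^{2k} satisfies lim_{m→∞} #(m·P_{C_{2k}} ∩ ℤ^{2k}) / m^{2k−1} = k·C(2k,k) / (2k−1)!. (Equivalently, the normalized volume of the (2k−1)-dimensional polytope P_{C_{2k}} equals k·C(2k,k).) -/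
open SimpleGraph Pointwise

/-- The cycle graph on vertex set `ZMod n`, with edges `{i, i+1}`. -/
def cycleGraphZMod (n : ℕ) : SimpleGraph (ZMod n) :=
  SimpleGraph.fromRel (fun i j => j = i + 1)

/-- The number of lattice points in the `m`-th dilate of `P ⊆ ℝ^V`. -/
noncomputable def latticePointCount {V : Type*} (P : Set (V → ℝ)) (m : ℕ) : ℕ :=
  Nat.card {x : V → ℝ // x ∈ (m : ℝ) • P ∧ ∀ v, ∃ z : ℤ, x v = z}

open Finset in
lemma aux_const {n : ℕ} [NeZero n] {R : Type*} [AddCommGroup R] (g : ZMod n → R)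
    (h : ∀ v, g v = g (v - 1)) (v : ZMod n) : g v = g 0 := by
  have key : ∀ i : ℕ, g (i : ZMod n) = g 0 := by
    intro i
    induction i with
    | zero => simp
    | succ i ih => rw [h]; simpa using ih
  have := key v.val
  rwa [ZMod.natCast_zmod_val] at this

/-- difference operator -/
def dOp (n : ℕ) (c : ZMod n → ℝ) : ZMod n → ℝ := fun v => c v - c (v - 1)

lemma dOp_single (n : ℕ) (v : ZMod n) :
    dOp n (Pi.single v 1) = Pi.single v 1 - Pi.single (v + 1) 1 := by
  ext w
  simp [dOp, Pi.single_apply, sub_eq_iff_eq_add]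

lemma aux_sub {n : ℕ} [NeZero n] {x : ZMod n → ℝ}
    (hx : x ∈ symEdgePolytope (cycleGraphZMod n)) :
    ∃ c, ∑ v, |c v| ≤ 1 ∧ x = dOp n c := by
  have : symEdgePolytope (cycleGraphZMod n) ⊆ {x | ∃ c, ∑ v, |c v| ≤ 1 ∧ x = dOp n c} := by
    apply convexHull_min
    · rintro x ⟨v, w, hvw, rfl⟩
      rw [cycleGraphZMod, SimpleGraph.fromRel_adj] at hvw
      obtain ⟨-, rfl | rfl⟩ := hvw
      · refine ⟨Pi.single v 1, ?_, (dOp_single n v).symm⟩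
        simp [Pi.single_apply, apply_ite abs]
      · refine ⟨-Pi.single w 1, ?_, ?_⟩
        · simp [Pi.single_apply, apply_ite abs]
        · have := dOp_single n w
          rw [← neg_sub, ← this]
          ext u; simp [dOp]; ring
    · rintro x ⟨c, hc, rfl⟩ y ⟨d, hd, rfl⟩ a b ha hb hab
      refine ⟨a • c + b • d, ?_, ?_⟩
      · calc ∑ v, |(a • c + b • d) v| ≤ ∑ v, (a * |c v| + b * |d v|) := by
              apply Finset.sum_le_sum
              intro v _
              simp only [Pi.add_apply, Pi.smul_apply, smul_eq_mul]
              refine (abs_add_le _ _).trans ?_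
              rw [abs_mul, abs_mul, abs_of_nonneg ha, abs_of_nonneg hb]
          _ = a * ∑ v, |c v| + b * ∑ v, |d v| := by
              rw [Finset.sum_add_distrib, Finset.mul_sum, Finset.mul_sum]
          _ ≤ 1 := by nlinarith
      · ext u; simp [dOp]; ring
  exact this hx

lemma aux_sup {n : ℕ} [NeZero n] (hn : 2 ≤ n) (c : ZMod n → ℝ) (hc : ∑ v, |c v| ≤ 1) :
    dOp n c ∈ symEdgePolytope (cycleGraphZMod n) := by
  haveI : Fact (1 < n) := ⟨hn⟩
  set P := symEdgePolytope (cycleGraphZMod n) with hP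
  have hconv : Convex ℝ P := convex_convexHull _ _
  have h1 : ∀ v : ZMod n, (Pi.single v 1 - Pi.single (v + 1) 1 : ZMod n → ℝ) ∈ P := by
    intro v
    apply subset_convexHull
    refine ⟨v, v + 1, ?_, rfl⟩
    rw [cycleGraphZMod, SimpleGraph.fromRel_adj]
    simp
  have h2 : ∀ v : ZMod n, (Pi.single (v + 1) 1 - Pi.single v 1 : ZMod n → ℝ) ∈ P := by
    intro v
    apply subset_convexHull
    refine ⟨v + 1, v, ?_, rfl⟩
    rw [cycleGraphZMod, SimpleGraph.fromRel_adj]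
    simp
  have h0 : (0 : ZMod n → ℝ) ∈ P := by
    have := hconv (h1 0) (h2 0) (a := 1/2) (b := 1/2) (by norm_num) (by norm_num) (by norm_num)
    convert this using 1
    rw [← neg_sub, smul_neg]; simp
  let w : Option (ZMod n) → ℝ := fun o => o.elim (1 - ∑ v, |c v|) (fun v => |c v|)
  let z : Option (ZMod n) → ZMod n → ℝ := fun o => o.elim 0
    (fun v => if 0 ≤ c v then Pi.single v 1 - Pi.single (v + 1) 1
      else Pi.single (v + 1) 1 - Pi.single v 1)
  have := hconv.sum_mem (t := Finset.univ) (w := w) (z := z) ?_ ?_ ?_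
  · convert this using 1
    rw [Fintype.sum_option]
    simp only [w, z, Option.elim, smul_zero, zero_add]
    have : ∀ v : ZMod n, (|c v| • if 0 ≤ c v then Pi.single v 1 - Pi.single (v + 1) 1
      else (Pi.single (v + 1) 1 - Pi.single v 1 : ZMod n → ℝ)) =
        c v • (Pi.single v 1 - Pi.single (v + 1) 1) := by
      intro v
      split_ifs with h
      · rw [abs_of_nonneg h]
      · rw [abs_of_neg (not_le.mp h), neg_smul, ← smul_neg, neg_sub]
    simp only [this]
    ext u
    simp [dOp, Finset.sum_apply, Pi.single_apply, mul_sub, Finset.sum_sub_distrib,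
      ← sub_eq_iff_eq_add]
  · rintro (_ | v) _
    · simp only [w, Option.elim]; linarith
    · simp only [w, Option.elim]; positivity
  · rw [Fintype.sum_option]; simp [w]
  · rintro (_ | v) _
    · exact h0
    · simp only [z, Option.elim]
      split_ifs
      · exact h1 v
      · exact h2 v

lemma aux_mem {n : ℕ} [NeZero n] (hn : 2 ≤ n) {m : ℕ} (hm : 0 < m) (x : ZMod n → ℝ) :
    x ∈ (m : ℝ) • symEdgePolytope (cycleGraphZMod n) ↔
      ∃ c, ∑ v, |c v| ≤ (m : ℝ) ∧ x = dOp n c := by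
  have hm' : (0 : ℝ) < m := by exact_mod_cast hm
  constructor
  · rintro ⟨y, hy, rfl⟩
    obtain ⟨c, hc, rfl⟩ := aux_sub hy
    refine ⟨(m : ℝ) • c, ?_, ?_⟩
    · simp only [Pi.smul_apply, smul_eq_mul, abs_mul, abs_of_pos hm', ← Finset.mul_sum]
      nlinarith
    · ext u; simp [dOp]; ring
  · rintro ⟨c, hc, rfl⟩
    refine ⟨dOp n ((m : ℝ)⁻¹ • c), aux_sup hn _ ?_, ?_⟩
    · simp only [Pi.smul_apply, smul_eq_mul, abs_mul, abs_inv, abs_of_pos hm', ← Finset.mul_sum]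
      rw [inv_mul_le_iff₀ hm']; simpa using hc
    · ext u; simp [dOp]; field_simp

lemma aux_split {V : Type*} [Fintype V] [DecidableEq V] (c : V → ℝ) (r : ℕ)
    (hr : r ≤ Fintype.card V) :
    ∃ A : Finset V, A.card = r ∧ ∀ a ∈ A, ∀ b ∉ A, c a ≤ c b := by
  induction r with
  | zero => exact ⟨∅, by simp, by simp⟩
  | succ r ih =>
    obtain ⟨A, hA, h⟩ := ih (by omega)
    have hne : (Aᶜ).Nonempty := by
      rw [← Finset.card_pos, Finset.card_compl]; omega
    obtain ⟨j, hj, hmin⟩ := Finset.exists_min_image _ c hne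
    rw [Finset.mem_compl] at hj
    refine ⟨insert j A, by rw [Finset.card_insert_of_notMem hj, hA], ?_⟩
    intro a ha b hb
    rw [Finset.mem_insert, not_or] at hb
    rcases Finset.mem_insert.mp ha with rfl | ha
    · exact hmin b (by simpa using hb.2)
    · exact h a ha b hb.2

/-- index pairs -/
def idx (n k : ℕ) [NeZero n] : Finset (Σ _ : ZMod n, Finset (ZMod n)) :=
  Finset.univ.sigma fun j => Finset.powersetCard (k - 1) (Finset.univ.erase j)

lemma idx_card (k : ℕ) [NeZero (2 * k)] (hk : 2 ≤ k) :
    (idx (2 * k) k).card = k * Nat.choose (2 * k) k := by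
  rw [idx, Finset.card_sigma]
  simp only [Finset.card_powersetCard, Finset.card_erase_of_mem (Finset.mem_univ _),
    Finset.card_univ, ZMod.card, Finset.sum_const, smul_eq_mul]
  obtain ⟨l, rfl⟩ : ∃ l, k = l + 1 := ⟨k - 1, by omega⟩
  have := Nat.add_one_mul_choose_eq (2 * l + 1) l
  have e : 2 * (l + 1) = 2 * l + 1 + 1 := by ring
  rw [e]
  simp only [Nat.add_sub_cancel]
  rw [this]; ring

lemma mem_idx {n k : ℕ} [NeZero n] {p : Σ _ : ZMod n, Finset (ZMod n)} :
    p ∈ idx n k ↔ p.1 ∉ p.2 ∧ p.2.card = k - 1 := by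
  simp [idx, Finset.mem_powersetCard, Finset.subset_erase]

/-- the potential -/
def gOp {n : ℕ} (p : Σ _ : ZMod n, Finset (ZMod n)) (y : ZMod n → ℕ) : ZMod n → ℝ :=
  fun v => if v = p.1 then 0 else if v ∈ p.2 then -(y v : ℝ) else y v

lemma W_card (n : ℕ) [NeZero n] (m : ℕ) :
    Nat.card {y : ZMod n → ℕ // ∑ v, y v = m} = (m + (n - 1)).choose (n - 1) := by
  rw [← Nat.card_congr (Sym.equivNatSumOfFintype (ZMod n) m), Nat.card_eq_fintype_card,
    Sym.card_sym_eq_choose, ZMod.card]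
  have := NeZero.pos n
  rw [show n + m - 1 = m + (n - 1) by omega, Nat.choose_symm_add]

instance W_fin (n : ℕ) [NeZero n] (m : ℕ) : Finite {y : ZMod n → ℕ // ∑ v, y v = m} :=
  Finite.of_equiv _ (Sym.equivNatSumOfFintype (ZMod n) m)

lemma gOp_abs {n : ℕ} [NeZero n] (p : Σ _ : ZMod n, Finset (ZMod n)) (y : ZMod n → ℕ) :
    ∑ v, |gOp p y v| ≤ ((∑ v, y v : ℕ) : ℝ) := by
  push_cast
  apply Finset.sum_le_sum
  intro v _
  unfold gOp
  split_ifs <;> simp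

/-- lattice points -/
def latSet (n m : ℕ) : Set (ZMod n → ℝ) :=
  {x | x ∈ (m : ℝ) • symEdgePolytope (cycleGraphZMod n) ∧ ∀ v, ∃ z : ℤ, x v = z}

/-- the parametrization -/
def pMap (n k m s : ℕ) [NeZero n] (q : idx n k × {y : ZMod n → ℕ // ∑ v, y v = m}) :
    ZMod n → ℝ := dOp n (gOp q.1.1 (fun v => q.2.1 v + s))

lemma gOp_int {n : ℕ} (p : Σ _ : ZMod n, Finset (ZMod n)) (y : ZMod n → ℕ) (v : ZMod n) :
    ∃ z : ℤ, gOp p y v = z := by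
  unfold gOp
  split_ifs
  · exact ⟨0, by simp⟩
  · exact ⟨-(y v : ℤ), by simp⟩
  · exact ⟨(y v : ℤ), by simp⟩

lemma upper (k m : ℕ) [NeZero (2 * k)] (hk : 2 ≤ k) (hm : 0 < m) :
    latSet (2 * k) m ⊆ Set.range (pMap (2 * k) k m 0) := by
  rintro x ⟨hx, hint⟩
  rw [aux_mem (by omega) hm] at hx
  obtain ⟨c, hc, rfl⟩ := hx
  obtain ⟨A, hA, hAs⟩ := aux_split c (k - 1) (by rw [ZMod.card]; omega)
  have hne : (Aᶜ).Nonempty := by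
    rw [← Finset.card_pos, Finset.card_compl, ZMod.card]; omega
  obtain ⟨j, hj, hmin⟩ := Finset.exists_min_image _ c hne
  rw [Finset.mem_compl] at hj
  -- integrality
  have hfr : ∀ v, ∃ z : ℤ, c v - c j = z := by
    have h1 : ∀ v, Int.fract (c v - c j) = Int.fract (c (v - 1) - c j) := by
      intro v
      obtain ⟨z, hz⟩ := hint v
      rw [Int.fract_eq_fract]
      exact ⟨z, by rw [← hz]; simp [dOp]⟩
    have h2 := aux_const (fun v => Int.fract (c v - c j)) h1
    intro v
    have h3 : Int.fract (c v - c j) = 0 := by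
      rw [h2 v, ← h2 j]; simp
    rw [Int.fract, sub_eq_zero] at h3
    exact ⟨_, h3⟩
  have hnat : ∀ v, ∃ t : ℕ, |c v - c j| = t := by
    intro v
    obtain ⟨z, hz⟩ := hfr v
    exact ⟨z.natAbs, by rw [hz, Nat.cast_natAbs, Int.cast_abs]⟩
  choose t ht using hnat
  have htj : t j = 0 := by
    have := ht j
    simp at this
    exact_mod_cast this.symm
  have hbound : ∑ v, |c v - c j| ≤ ∑ v, |c v| := by
    have e1 : ∑ v ∈ A, |c v - c j| = ((k - 1 : ℕ) : ℝ) * c j - ∑ v ∈ A, c v := by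
      rw [Finset.sum_congr rfl (fun v hv => by
        rw [abs_of_nonpos (by linarith [hAs v hv j hj]), neg_sub])]
      rw [Finset.sum_sub_distrib]; simp [hA]
    have e2 : ∑ v ∈ Aᶜ, |c v - c j| = ∑ v ∈ Aᶜ, c v - ((k + 1 : ℕ) : ℝ) * c j := by
      rw [Finset.sum_congr rfl (fun v hv => by
        rw [abs_of_nonneg (by linarith [hmin v hv])])]
      have : (Aᶜ).card = k + 1 := by rw [Finset.card_compl, ZMod.card]; omega
      rw [Finset.sum_sub_distrib, Finset.sum_const, this, nsmul_eq_mul]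
    have hj' : j ∈ Aᶜ := by simpa using hj
    rw [← Finset.sum_add_sum_compl A, e1, e2, ← Finset.sum_add_sum_compl A (fun v => |c v|)]
    have e3 : ∑ v ∈ A, -c v ≤ ∑ v ∈ A, |c v| := Finset.sum_le_sum fun v _ => neg_le_abs _
    have e4 : ∑ v ∈ (Aᶜ).erase j, c v ≤ ∑ v ∈ (Aᶜ).erase j, |c v| :=
      Finset.sum_le_sum fun v _ => le_abs_self _
    rw [← Finset.add_sum_erase _ _ hj', ← Finset.add_sum_erase _ (fun v => |c v|) hj']
    rw [Finset.sum_neg_distrib] at e3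
    rw [Nat.cast_sub (by omega)]
    push_cast
    have := neg_le_abs (c j)
    linarith
  have htm : ∑ v, t v ≤ m := by
    have : ((∑ v, t v : ℕ) : ℝ) ≤ m := by
      push_cast
      simp only [← ht]
      linarith
    exact_mod_cast this
  let y : ZMod (2 * k) → ℕ := fun v => if v = j then m - ∑ v, t v else t v
  have hy : ∑ v, y v = m := by
    rw [← Finset.add_sum_erase _ _ (Finset.mem_univ j)]
    have h5 : ∑ v ∈ Finset.univ.erase j, y v = ∑ v ∈ Finset.univ.erase j, t v :=
      Finset.sum_congr rfl fun v hv => by simp [y, Finset.ne_of_mem_erase hv]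
    have h6 := Finset.add_sum_erase _ t (Finset.mem_univ j)
    rw [h5]
    simp only [y, if_true]
    omega
  refine ⟨⟨⟨⟨j, A⟩, mem_idx.mpr ⟨hj, hA⟩⟩, ⟨y, hy⟩⟩, ?_⟩
  have hg : ∀ v, gOp (⟨j, A⟩ : Σ _ : ZMod (2 * k), Finset (ZMod (2 * k))) (fun v => y v + 0) v
      = c v - c j := by
    intro v
    simp only [gOp, add_zero, y]
    split_ifs with h1 h2
    · simp [h1]
    · rw [← ht, abs_of_nonpos (by linarith [hAs v h2 j hj])]; ring
    · rw [← ht, abs_of_nonneg (by linarith [hmin v (by simpa using h2)])]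
  ext v
  simp only [pMap, dOp, hg]
  ring

lemma lower_mem (k m : ℕ) [NeZero (2 * k)] (hk : 2 ≤ k) (hm : 2 * k ≤ m) :
    Set.range (pMap (2 * k) k (m - 2 * k) 1) ⊆ latSet (2 * k) m := by
  rintro _ ⟨⟨⟨p, hp⟩, ⟨y, hy⟩⟩, rfl⟩
  refine ⟨(aux_mem (by omega) (by omega) _).mpr ⟨_, ?_, rfl⟩, ?_⟩
  · refine (gOp_abs _ _).trans ?_
    simp only [Finset.sum_add_distrib, hy]
    simp [ZMod.card]
    rw [Nat.cast_sub hm]; push_cast; linarith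
  · intro v
    obtain ⟨a, ha⟩ := gOp_int p (fun v => y v + 1) v
    obtain ⟨b, hb⟩ := gOp_int p (fun v => y v + 1) (v - 1)
    exact ⟨a - b, by simp only [pMap, dOp, ha, hb]; push_cast; ring⟩

lemma gOp_pos {n : ℕ} [NeZero n] (p : Σ _ : ZMod n, Finset (ZMod n)) (y : ZMod n → ℕ)
    (v : ZMod n) : 0 < gOp p (fun v => y v + 1) v ↔ v ∉ insert p.1 p.2 := by
  unfold gOp
  have : (0 : ℝ) < (y v + 1 : ℕ) := by positivity
  rw [Finset.mem_insert, not_or]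
  split_ifs with h1 h2
  · simp [h1]
  · simp only [h1, h2, not_true, and_false, iff_false, not_lt]; linarith
  · simp only [h1, h2, this]; simp

lemma gOp_neg {n : ℕ} [NeZero n] (p : Σ _ : ZMod n, Finset (ZMod n)) (hp : p.1 ∉ p.2)
    (y : ZMod n → ℕ)
    (v : ZMod n) : gOp p (fun v => y v + 1) v < 0 ↔ v ∈ p.2 := by
  unfold gOp
  have : (0 : ℝ) < (y v + 1 : ℕ) := by positivity
  split_ifs with h1 h2
  · simp [h1, hp]
  · simp only [h2, iff_true]; linarith
  · simp only [h2, iff_false]; linarith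

lemma shift_le (k : ℕ) [NeZero (2 * k)] (hk : 2 ≤ k)
    (p p' : Σ _ : ZMod (2 * k), Finset (ZMod (2 * k))) (hp : p ∈ idx (2 * k) k)
    (hp' : p' ∈ idx (2 * k) k) (y y' : ZMod (2 * k) → ℕ) (t : ℝ)
    (h : ∀ v, gOp p (fun v => y v + 1) v = gOp p' (fun v => y' v + 1) v + t) : t ≤ 0 := by
  by_contra! ht
  rw [mem_idx] at hp hp'
  have hsub : insert p.1 p.2 ⊆ p'.2 := by
    intro v hv
    have h1 := (gOp_pos p y v).not.mpr (not_not.mpr hv)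
    rw [← gOp_neg p' hp'.1 y']
    linarith [h v]
  have := Finset.card_le_card hsub
  rw [Finset.card_insert_of_notMem hp.1] at this
  omega

lemma lower_inj (k m : ℕ) [NeZero (2 * k)] (hk : 2 ≤ k) :
    Function.Injective (pMap (2 * k) k m 1) := by
  rintro ⟨⟨p, hp⟩, ⟨y, hy⟩⟩ ⟨⟨p', hp'⟩, ⟨y', hy'⟩⟩ heq
  simp only [pMap] at heq
  set g := gOp p (fun v => y v + 1) with hg
  set g' := gOp p' (fun v => y' v + 1) with hg'
  have hconst := aux_const (fun v => g v - g' v) (fun v => by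
    have := congrFun heq v
    simp only [dOp] at this
    linarith)
  have ht1 := shift_le k hk p p' hp hp' y y' (g 0 - g' 0) (fun v => by linarith [hconst v])
  have ht2 := shift_le k hk p' p hp' hp y' y (-(g 0 - g' 0)) (fun v => by linarith [hconst v])
  have hgg : ∀ v, g v = g' v := fun v => by linarith [hconst v]
  have hp1 := (mem_idx.mp hp).1
  have hp1' := (mem_idx.mp hp').1
  have hA : p.2 = p'.2 := by
    ext v
    rw [← gOp_neg p hp1 y, ← gOp_neg p' hp1' y', ← hg, ← hg', hgg]
  have hI : insert p.1 p.2 = insert p'.1 p'.2 := by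
    ext v
    rw [← not_iff_not, ← gOp_pos p y, ← gOp_pos p' y', ← hg, ← hg', hgg]
  have hj : p.1 = p'.1 := by
    have : p.1 ∈ insert p'.1 p'.2 := hI ▸ Finset.mem_insert_self _ _
    rcases Finset.mem_insert.mp this with h | h
    · exact h
    · exact absurd (hA ▸ h) hp1
  have hpp : p = p' := Sigma.ext hj (heq_of_eq hA)
  subst hpp
  have hyy : ∀ v, v ≠ p.1 → y v = y' v := by
    intro v hv
    have := hgg v
    simp only [hg, hg', gOp, if_neg hv] at this
    split_ifs at this
    · have := neg_injective this
      simpa using this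
    · simpa using this
  have hyj : y p.1 = y' p.1 := by
    rw [← Finset.add_sum_erase _ _ (Finset.mem_univ p.1)] at hy hy'
    have : ∑ v ∈ Finset.univ.erase p.1, y v = ∑ v ∈ Finset.univ.erase p.1, y' v :=
      Finset.sum_congr rfl fun v hv => hyy v (Finset.ne_of_mem_erase hv)
    omega
  have : y = y' := by
    ext v
    by_cases h : v = p.1
    · rw [h, hyj]
    · exact hyy v h
  subst this
  rfl

lemma count_le (k m : ℕ) [NeZero (2 * k)] (hk : 2 ≤ k) (hm : 0 < m) :
    latticePointCount (symEdgePolytope (cycleGraphZMod (2 * k))) m ≤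
      k * Nat.choose (2 * k) k * (m + (2 * k - 1)).choose (2 * k - 1) := by
  have h1 : latticePointCount (symEdgePolytope (cycleGraphZMod (2 * k))) m =
    (latSet (2 * k) m).ncard := rfl
  rw [h1]
  refine (Set.ncard_le_ncard (upper k m hk hm) (Set.finite_range _)).trans ?_
  rw [← Nat.card_coe_set_eq]
  refine (Finite.card_range_le _).trans ?_
  rw [Nat.card_prod, W_card, Nat.card_eq_fintype_card, Fintype.card_coe, idx_card k hk]

lemma le_count (k m : ℕ) [NeZero (2 * k)] (hk : 2 ≤ k) (hm : 2 * k ≤ m) :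
    k * Nat.choose (2 * k) k * (m - 1).choose (2 * k - 1) ≤
    latticePointCount (symEdgePolytope (cycleGraphZMod (2 * k))) m := by
  have h1 : latticePointCount (symEdgePolytope (cycleGraphZMod (2 * k))) m =
    (latSet (2 * k) m).ncard := rfl
  rw [h1]
  refine le_trans ?_ (Set.ncard_le_ncard (lower_mem k m hk hm)
    ((Set.finite_range _).subset (upper k m hk (by omega))))
  rw [← Nat.card_coe_set_eq, Nat.card_range_of_injective (lower_inj k _ hk)]
  rw [Nat.card_prod, W_card, Nat.card_eq_fintype_card, Fintype.card_coe, idx_card k hk]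
  rw [show m - 2 * k + (2 * k - 1) = m - 1 by omega]

lemma lim_aux (r : ℕ) (a : ℝ) :
    Filter.Tendsto (fun m : ℕ => (((m : ℝ) + a) ^ r / r.factorial) / (m : ℝ) ^ r) Filter.atTop
      (nhds (1 / (r.factorial : ℝ))) := by
  have h1 : Filter.Tendsto (fun m : ℕ => (1 + a / (m : ℝ)) ^ r / r.factorial) Filter.atTop
      (nhds ((1 + 0) ^ r / (r.factorial : ℝ))) :=
    ((tendsto_const_nhds.add (tendsto_const_div_atTop_nhds_zero_nat a)).pow r).div_const _
  rw [add_zero, one_pow] at h1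
  refine h1.congr' ?_
  filter_upwards [Filter.eventually_gt_atTop 0] with m hm
  have : (m : ℝ) ≠ 0 := by positivity
  rw [div_right_comm, ← div_pow, add_div, div_self this]

theorem stmt5 (k : ℕ) (hk : 2 ≤ k) :
    Filter.Tendsto
      (fun m : ℕ =>
        (latticePointCount (symEdgePolytope (cycleGraphZMod (2 * k))) m : ℝ) /
          (m : ℝ) ^ (2 * k - 1))
      Filter.atTop
      (nhds (((k * Nat.choose (2 * k) k : ℕ) : ℝ) / (Nat.factorial (2 * k - 1) : ℝ))) := by
  haveI : NeZero (2 * k) := ⟨by omega⟩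
  set K := k * Nat.choose (2 * k) k with hK
  set r := 2 * k - 1 with hr
  have hlo := (lim_aux r (-(r : ℝ))).const_mul (K : ℝ)
  have hhi := (lim_aux r (r : ℝ)).const_mul (K : ℝ)
  rw [mul_one_div] at hlo hhi
  refine tendsto_of_tendsto_of_tendsto_of_le_of_le' hlo hhi ?_ ?_
  · filter_upwards [Filter.eventually_ge_atTop (2 * k)] with m hm
    have h1 := le_count k m hk hm
    rw [← hK, ← hr] at h1
    have h2 := Nat.pow_le_choose (α := ℝ) r (m - 1)
    rw [show m - 1 + 1 - r = m - r by omega, Nat.cast_sub (by omega)] at h2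
    rw [← mul_div_assoc]
    gcongr
    calc (K : ℝ) * (((m : ℝ) + -r) ^ r / r.factorial) ≤ K * ((m - 1).choose r : ℕ) := by
          gcongr
          simpa [sub_eq_add_neg] using h2
      _ ≤ _ := by exact_mod_cast h1
  · filter_upwards [Filter.eventually_gt_atTop 0] with m hm
    have h1 := count_le k m hk hm
    rw [← hK, ← hr] at h1
    have h2 := Nat.choose_le_pow_div (α := ℝ) r (m + r)
    rw [← mul_div_assoc]
    gcongr
    calc _ ≤ (K : ℝ) * ((m + r).choose r : ℕ) := by exact_mod_cast h1
      _ ≤ _ := by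
          gcongr
          simpa using h2
end

section
/- Let G1 = (V1, E1) be a finite simple connected graph and G2 = (V2, E2) a finite simple connected bipartite graph such that V1 ∩ V2 = {v, w}, the pair {v,w} is an edge of both graphs, and E1 ∩ E2 = {{v,w}}; let G = (V1 ∪ V2, E1 ∪ E2). For a graph H = (V,E) write L_H(m) := #(m·P_H ∩ ℤ^V) for the Ehrhart counting function of the symmetric edge polytope P_H. Then the following identity of formal power series in ℚ[[t]] holds: (1+t) · Σ_{m≥0} L_G(m) t^m = (1−t)² · (Σ_{m≥0} L_{G1}(m) t^m) · (Σ_{m≥0} L_{G2}(m) t^m). (Equivalently, the h*-polynomial of P_G equals the product of the h*-polynomials of P_{G1} and P_{G2} divided by (1+t).) -/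
open SimpleGraph Pointwise

set_option linter.unusedSectionVars false


section flows
variable {V : Type*} [Fintype V] [DecidableEq V]

def edgeM {R : Type*} [CommRing R] (p q : V) : V → V → R := fun a b =>
  (if a = p ∧ b = q then 1 else 0) - (if a = q ∧ b = p then 1 else 0)

lemma edgeM_anti {R : Type*} [CommRing R] (p q a b : V) : (edgeM p q a b : R) = - edgeM p q b a := by
  unfold edgeM; simp only [and_comm (a := b = p), and_comm (a := b = q)]; ring

lemma edgeM_sum {R : Type*} [CommRing R] (p q a : V) : ∑ b, (edgeM p q a b : R) =
    (if a = p then 1 else 0) - (if a = q then 1 else 0) := by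
  unfold edgeM
  rw [Finset.sum_sub_distrib]
  simp only [ite_and]
  by_cases h1 : a = p <;> by_cases h2 : a = q <;> simp [h1, h2]

lemma edgeM_ne {R : Type*} [CommRing R] {p q a b : V} (h : (edgeM p q a b : R) ≠ 0) : (a = p ∧ b = q) ∨ (a = q ∧ b = p) := by
  by_contra hc
  push Not at hc
  apply h
  unfold edgeM
  rw [if_neg (by tauto), if_neg (by tauto)]; simp

lemma path_flow (S : SimpleGraph V) {p q : V} (h : S.Reachable p q) :
    ∃ z : V → V → ℝ, (∀ u w, z u w = - z w u) ∧ (∀ u w, z u w ≠ 0 → S.Adj u w) ∧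
      ∀ u, ∑ w, z u w = (if u = p then 1 else 0) - (if u = q then 1 else 0) := by
  obtain ⟨c⟩ := h
  induction c with
  | nil => exact ⟨fun _ _ => 0, by simp, by simp, by simp⟩
  | @cons p r q hpr c ih =>
    obtain ⟨z, h1, h2, h3⟩ := ih
    refine ⟨fun a b => z a b + edgeM p r a b, ?_, ?_, ?_⟩
    · intro u w
      beta_reduce
      rw [h1 u w, edgeM_anti p r u w]; ring
    · intro u w hne
      beta_reduce at hne
      by_cases hz : z u w = 0
      · rw [hz, zero_add] at hne
        rcases edgeM_ne hne with ⟨rfl, rfl⟩ | ⟨rfl, rfl⟩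
        · exact hpr
        · exact hpr.symm
      · exact h2 u w hz
    · intro u
      rw [Finset.sum_add_distrib, h3, edgeM_sum]; ring

abbrev II : AddSubgroup ℝ := (Int.castAddHom ℝ).range

lemma mem_II {x : ℝ} : x ∈ II ↔ ∃ z : ℤ, (z : ℝ) = x := Iff.rfl

/-- kernel vector -/
lemma exists_cycle_flow (f : V → V → ℝ) (ha : ∀ u w, f u w = - f w u)
    (hI : ∀ u, ∑ w, f u w ∈ II) {a b : V} (hab : f a b ∉ II) :
    ∃ z : V → V → ℝ, (∀ u w, z u w = - z w u) ∧ (∀ u w, z u w ≠ 0 → f u w ∉ II) ∧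
      (∀ u, ∑ w, z u w = 0) ∧ z a b ≠ 0 := by
  classical
  let S : SimpleGraph V :=
    { Adj := fun u w => f u w ∉ II ∧ ¬ (u = a ∧ w = b) ∧ ¬ (u = b ∧ w = a)
      symm := ⟨by
        rintro u w ⟨h1, h2, h3⟩
        refine ⟨?_, by tauto, by tauto⟩
        rw [ha w u]; simpa using h1⟩
      loopless := ⟨by
        rintro u ⟨h1, _⟩
        apply h1
        have : f u u = 0 := by linarith [ha u u]
        rw [this]; exact II.zero_mem⟩ }
  have hreach : S.Reachable b a := by
    by_contra hn
    let A : Finset V := Finset.univ.filter fun u => S.Reachable a u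
    have hAa : a ∈ A := by simp [A]
    have hAb : b ∉ A := by
      simp only [A, Finset.mem_filter, Finset.mem_univ, true_and]
      exact fun h => hn h.symm
    have h1 : ∑ u ∈ A, ∑ w, f u w ∈ II := II.sum_mem fun u _ => hI u
    have h2 : ∑ u ∈ A, ∑ w ∈ A, f u w = 0 := by
      have : ∑ u ∈ A, ∑ w ∈ A, f u w = - ∑ u ∈ A, ∑ w ∈ A, f u w := by
        conv_lhs => rw [Finset.sum_comm]
        rw [← Finset.sum_neg_distrib]
        refine Finset.sum_congr rfl fun u _ => ?_
        rw [← Finset.sum_neg_distrib]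
        exact Finset.sum_congr rfl fun w _ => ha w u
      linarith
    have h3 : ∑ u ∈ A, ∑ w ∈ Aᶜ, f u w ∈ II := by
      have : ∑ u ∈ A, ∑ w, f u w = ∑ u ∈ A, ∑ w ∈ A, f u w + ∑ u ∈ A, ∑ w ∈ Aᶜ, f u w := by
        rw [← Finset.sum_add_distrib]
        exact Finset.sum_congr rfl fun u _ => (Finset.sum_add_sum_compl A _).symm
      rw [this, h2, zero_add] at h1; exact h1
    have hcross : ∀ u ∈ A, ∀ w ∈ Aᶜ, ¬ (u = a ∧ w = b) → f u w ∈ II := by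
      intro u hu w hw hne
      by_contra hc
      have hadj : S.Adj u w := ⟨hc, hne, by rintro ⟨rfl, rfl⟩; exact hAb hu⟩
      rw [Finset.mem_compl] at hw
      apply hw
      simp only [A, Finset.mem_filter, Finset.mem_univ, true_and] at hu ⊢
      exact hu.trans hadj.reachable
    apply hab
    have hb' : b ∈ Aᶜ := by simpa using hAb
    rw [← Finset.add_sum_erase _ _ hAa, ← Finset.add_sum_erase _ _ hb', add_assoc] at h3
    refine (II.add_mem_cancel_right ?_).1 h3
    refine II.add_mem ?_ ?_
    · exact II.sum_mem fun w hw => hcross a hAa w (Finset.mem_of_mem_erase hw)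
        (fun h => (Finset.ne_of_mem_erase hw) h.2)
    · exact II.sum_mem fun u hu => II.sum_mem fun w hw =>
        hcross u (Finset.mem_of_mem_erase hu) w hw (fun h => (Finset.ne_of_mem_erase hu) h.1)
  have hne : a ≠ b := by
    rintro rfl
    apply hab
    have : f a a = 0 := by linarith [ha a a]
    rw [this]; exact II.zero_mem
  obtain ⟨z, z1, z2, z3⟩ := path_flow S hreach
  refine ⟨fun u w => z u w + edgeM a b u w, ?_, ?_, ?_, ?_⟩
  · intro u w
    beta_reduce
    rw [z1 u w, edgeM_anti a b u w]; ring
  · intro u w h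
    beta_reduce at h
    by_cases hz : z u w = 0
    · rw [hz, zero_add] at h
      rcases edgeM_ne h with ⟨rfl, rfl⟩ | ⟨rfl, rfl⟩
      · exact hab
      · rw [ha]; simpa using hab
    · exact (z2 u w hz).1
  · intro u
    rw [Finset.sum_add_distrib, z3, edgeM_sum]; ring
  · have : z a b = 0 := by
      by_contra h
      exact (z2 a b h).2.1 ⟨rfl, rfl⟩
    simp [this, edgeM, hne]


lemma round_flow (H : SimpleGraph V) (n : ℕ) : ∀ f : V → V → ℝ, (∀ u w, f u w = - f w u) →
    (∀ u w, f u w ≠ 0 → H.Adj u w) → (∀ u, ∑ w, f u w ∈ II) →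
    (Set.ncard {p : V × V | f p.1 p.2 ∉ II} = n) →
    ∃ g : V → V → ℤ, (∀ u w, g u w = - g w u) ∧ (∀ u w, g u w ≠ 0 → H.Adj u w) ∧
      (∀ u, ((∑ w, g u w : ℤ) : ℝ) = ∑ w, f u w) ∧
      ((∑ u, ∑ w, |g u w| : ℤ) : ℝ) ≤ ∑ u, ∑ w, |f u w| := by
  induction n using Nat.strong_induction_on with
  | _ n ih =>
  intro f ha hs hI hn
  by_cases hint : ∀ u w, f u w ∈ II
  · choose g hg using fun u w => mem_II.1 (hint u w)
    refine ⟨g, ?_, ?_, ?_, ?_⟩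
    · intro u w
      have := ha u w
      rw [← hg, ← hg] at this
      exact_mod_cast this
    · intro u w h
      apply hs
      rw [← hg]; exact_mod_cast h
    · intro u; push_cast; exact Finset.sum_congr rfl fun w _ => hg u w
    · push_cast
      simp_rw [hg]; rfl
  push Not at hint
  obtain ⟨a, b, hab⟩ := hint
  let sg : V → V → ℝ := fun u w => if 0 ≤ f u w then 1 else -1
  obtain ⟨z, z1, z2, z3, z4, z5⟩ : ∃ z : V → V → ℝ, (∀ u w, z u w = - z w u) ∧
      (∀ u w, z u w ≠ 0 → f u w ∉ II) ∧ (∀ u, ∑ w, z u w = 0) ∧ z a b ≠ 0 ∧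
      ∑ u, ∑ w, sg u w * z u w ≤ 0 := by
    obtain ⟨z, z1, z2, z3, z4⟩ := exists_cycle_flow f ha hI hab
    rcases le_total (∑ u, ∑ w, sg u w * z u w) 0 with h | h
    · exact ⟨z, z1, z2, z3, z4, h⟩
    · refine ⟨fun u w => - z u w, ?_, ?_, ?_, ?_, ?_⟩
      · intro u w; beta_reduce; rw [z1 u w]
      · intro u w h; exact z2 u w (by simpa using h)
      · intro u; simp [z3]
      · simpa using z4
      · simpa using h
  let t : V × V → ℝ := fun p => if 0 < z p.1 p.2 then (⌈f p.1 p.2⌉ - f p.1 p.2) / z p.1 p.2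
    else (f p.1 p.2 - ⌊f p.1 p.2⌋) / (- z p.1 p.2)
  obtain ⟨⟨p, q⟩, hpq, hmin⟩ := Finset.exists_min_image
    (Finset.univ.filter fun p : V × V => z p.1 p.2 ≠ 0) t ⟨(a, b), by simpa using z4⟩
  simp only [Finset.mem_filter, Finset.mem_univ, true_and] at hpq hmin
  set ε := t (p, q) with hε
  have tnn : ∀ r, 0 ≤ t r := by
    intro r
    simp only [t]
    split_ifs with h
    · exact div_nonneg (sub_nonneg.2 (Int.le_ceil _)) h.le
    · exact div_nonneg (sub_nonneg.2 (Int.floor_le _)) (by linarith)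
  have ε0 : 0 ≤ ε := tnn _
  let f' : V → V → ℝ := fun u w => f u w + ε * z u w
  have hbd : ∀ u w, (⌊f u w⌋ : ℝ) ≤ f' u w ∧ f' u w ≤ ⌈f u w⌉ := by
    intro u w
    simp only [f']
    have hl := Int.floor_le (f u w)
    have hc := Int.le_ceil (f u w)
    rcases lt_trichotomy (z u w) 0 with h | h | h
    · have hm := hmin (u, w) h.ne
      simp only [t, if_neg (not_lt.2 h.le)] at hm
      rw [le_div_iff₀ (by linarith)] at hm
      constructor <;> nlinarith
    · rw [h]; constructor <;> linarith
    · have hm := hmin (u, w) h.ne'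
      simp only [t, if_pos h] at hm
      rw [le_div_iff₀ h] at hm
      constructor <;> nlinarith
  have habs : ∀ u w, |f' u w| = |f u w| + ε * (sg u w * z u w) := by
    intro u w
    obtain ⟨h1, h2⟩ := hbd u w
    simp only [sg]
    split_ifs with h
    · have : (0 : ℝ) ≤ ⌊f u w⌋ := by exact_mod_cast Int.floor_nonneg.2 h
      rw [abs_of_nonneg h, abs_of_nonneg (this.trans h1)]; simp only [f']; ring
    · have h' : f u w ≤ 0 := by linarith
      have : (⌈f u w⌉ : ℝ) ≤ 0 := by exact_mod_cast Int.ceil_le.2 (by simpa using h')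
      rw [abs_of_nonpos h', abs_of_nonpos (h2.trans this)]; simp only [f']; ring
  have hpqI : f' p q ∈ II := by
    rw [mem_II]
    by_cases h : 0 < z p q
    · refine ⟨⌈f p q⌉, ?_⟩
      simp only [f', hε, t, if_pos h]; field_simp; ring
    · refine ⟨⌊f p q⌋, ?_⟩
      simp only [f', hε, t, if_neg h]; field_simp; ring
  have hkeep : ∀ u w, f u w ∈ II → f' u w = f u w := by
    intro u w h
    have : z u w = 0 := by
      by_contra hc
      exact z2 u w hc h
    simp [f', this]
  have hsub : {r : V × V | f' r.1 r.2 ∉ II} ⊂ {r : V × V | f r.1 r.2 ∉ II} := by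
    refine ⟨?_, fun h => ?_⟩
    · intro r hr hc
      apply hr
      rw [hkeep _ _ hc]; exact hc
    · exact h (show (p, q) ∈ _ from z2 p q hpq) hpqI
  have hrow : ∀ u, ∑ w, f' u w = ∑ w, f u w := by
    intro u
    simp only [f']
    rw [Finset.sum_add_distrib, ← Finset.mul_sum, z3]; simp
  obtain ⟨g, g1, g2, g3, g4⟩ := ih _ (hn ▸ Set.ncard_lt_ncard hsub (Set.toFinite _)) f'
    (by intro u w; simp only [f']; rw [ha u w, z1 u w]; ring)
    (by
      intro u w h
      apply hs
      intro hc
      apply h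
      rw [hkeep u w (by rw [hc]; exact II.zero_mem), hc])
    (by intro u; rw [hrow]; exact hI u) rfl
  refine ⟨g, g1, g2, fun u => (g3 u).trans (hrow u), g4.trans ?_⟩
  simp_rw [habs, Finset.sum_add_distrib, ← Finset.mul_sum]
  nlinarith

/-- `x` is a sum of `n` edge vectors. -/
inductive Reach (H : SimpleGraph V) : ℕ → (V → ℤ) → Prop
  | zero : Reach H 0 0
  | step {n x u w} : Reach H n x → H.Adj u w →
      Reach H (n + 1) (x + (Pi.single u 1 - Pi.single w 1))

lemma Reach.of_flow (H : SimpleGraph V) (s : ℕ) : ∀ g : V → V → ℤ, (∀ u w, g u w = - g w u) →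
    (∀ u w, g u w ≠ 0 → H.Adj u w) → (∑ u, ∑ w, |g u w| = s) →
    ∃ n : ℕ, 2 * n = s ∧ Reach H n (fun u => ∑ w, g u w) := by
  induction s using Nat.strong_induction_on with
  | _ s ih =>
  intro g ha hs hsum
  by_cases h0 : ∀ u w, g u w = 0
  · refine ⟨0, ?_, ?_⟩
    · simp [h0] at hsum; omega
    · have : (fun u => ∑ w, g u w) = 0 := by funext u; simp [h0]
      rw [this]; exact Reach.zero
  obtain ⟨a, b, hab⟩ : ∃ a b, 0 < g a b := by
    push Not at h0
    obtain ⟨a, b, hab⟩ := h0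
    rcases lt_or_gt_of_ne hab with h | h
    · exact ⟨b, a, by rw [ha]; omega⟩
    · exact ⟨a, b, h⟩
  have hba : g b a < 0 := by rw [ha]; omega
  have hne : a ≠ b := by
    rintro rfl; omega
  let g' : V → V → ℤ := fun u w => g u w - edgeM a b u w
  have habs : ∀ u w, |g u w| = |g' u w| + ((if u = a ∧ w = b then 1 else 0) +
      (if u = b ∧ w = a then 1 else 0)) := by
    intro u w
    simp only [g', edgeM]
    by_cases h1 : u = a ∧ w = b
    · obtain ⟨rfl, rfl⟩ := h1
      simp only [and_self, if_true, hne, false_and, if_false, sub_zero, add_zero]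
      rw [abs_of_pos hab, abs_of_nonneg (by omega)]; ring
    · by_cases h2 : u = b ∧ w = a
      · obtain ⟨rfl, rfl⟩ := h2
        simp only [and_self, if_true, hne.symm, false_and, if_false, zero_add]
        rw [abs_of_neg hba, abs_of_nonpos (by omega)]; ring
      · simp [h1, h2]
  have hs2 : ∑ u, ∑ w, |g u w| = ∑ u, ∑ w, |g' u w| + 2 := by
    simp_rw [habs, Finset.sum_add_distrib, ite_and]
    simp
  have hnn : 0 ≤ ∑ u, ∑ w, |g' u w| :=
    Finset.sum_nonneg fun u _ => Finset.sum_nonneg fun w _ => abs_nonneg _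
  obtain ⟨n, hn, hr⟩ := ih (s - 2) (by omega) g'
    (by intro u w; simp only [g']; rw [ha u w, edgeM_anti a b u w]; ring)
    (by
      intro u w h
      by_cases he : (edgeM a b u w : ℤ) = 0
      · apply hs; simpa [g', he] using h
      · rcases edgeM_ne he with ⟨rfl, rfl⟩ | ⟨rfl, rfl⟩
        · exact hs _ _ hab.ne'
        · exact hs _ _ hba.ne)
    (by omega)
  refine ⟨n + 1, by omega, ?_⟩
  have : (fun u => ∑ w, g u w) = (fun u => ∑ w, g' u w) + (Pi.single a 1 - Pi.single b 1) := by
    funext u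
    simp only [g', Pi.add_apply, Pi.sub_apply, Finset.sum_sub_distrib, edgeM_sum, Pi.single_apply]
    ring
  rw [this]
  exact hr.step (hs _ _ hab.ne')

lemma polytope_flow (H : SimpleGraph V) {x : V → ℝ} (hx : x ∈ symEdgePolytope H) :
    ∃ f : V → V → ℝ, (∀ u w, f u w = - f w u) ∧ (∀ u w, f u w ≠ 0 → H.Adj u w) ∧
      (∀ u, ∑ w, f u w = x u) ∧ ∑ u, ∑ w, |f u w| ≤ 2 := by
  let T : Set (V → ℝ) := {x | ∃ f : V → V → ℝ, (∀ u w, f u w = - f w u) ∧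
    (∀ u w, f u w ≠ 0 → H.Adj u w) ∧ (∀ u, ∑ w, f u w = x u) ∧ ∑ u, ∑ w, |f u w| ≤ 2}
  suffices h : symEdgePolytope H ⊆ T from h hx
  apply convexHull_min
  · rintro _ ⟨a, b, hab, rfl⟩
    refine ⟨edgeM a b, edgeM_anti a b, ?_, ?_, ?_⟩
    · intro u w h
      rcases edgeM_ne h with ⟨rfl, rfl⟩ | ⟨rfl, rfl⟩
      · exact hab
      · exact hab.symm
    · intro u
      rw [edgeM_sum]; simp [Pi.single_apply]
    · have : ∀ u w, |(edgeM a b u w : ℝ)| ≤ (if u = a ∧ w = b then 1 else 0) +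
          (if u = b ∧ w = a then 1 else 0) := by
        intro u w
        unfold edgeM
        refine (abs_sub _ _).trans ?_
        split_ifs <;> simp
      refine (Finset.sum_le_sum fun u _ => Finset.sum_le_sum fun w _ => this u w).trans ?_
      simp_rw [Finset.sum_add_distrib, ite_and]
      simp
      norm_num
  · rintro x ⟨f, f1, f2, f3, f4⟩ y ⟨g, g1, g2, g3, g4⟩ α β hα hβ hαβ
    refine ⟨fun u w => α * f u w + β * g u w, ?_, ?_, ?_, ?_⟩
    · intro u w; beta_reduce; rw [f1 u w, g1 u w]; ring
    · intro u w h
      by_cases hf : f u w = 0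
      · apply g2; intro hg; apply h; simp [hf, hg]
      · exact f2 u w hf
    · intro u
      rw [Finset.sum_add_distrib, ← Finset.mul_sum, ← Finset.mul_sum, f3, g3]; simp
    · have : ∀ u w, |α * f u w + β * g u w| ≤ α * |f u w| + β * |g u w| := by
        intro u w
        refine (abs_add_le _ _).trans ?_
        rw [abs_mul, abs_mul, abs_of_nonneg hα, abs_of_nonneg hβ]
      refine (Finset.sum_le_sum fun u _ => Finset.sum_le_sum fun w _ => this u w).trans ?_
      simp_rw [Finset.sum_add_distrib, ← Finset.mul_sum]
      nlinarith

def toR (x : V → ℤ) : V → ℝ := fun u => (x u : ℝ)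

lemma reach_of_mem (H : SimpleGraph V) {r : ℝ} (hr : 0 ≤ r) {x : V → ℤ}
    (hx : toR x ∈ r • symEdgePolytope H) : ∃ n : ℕ, (n : ℝ) ≤ r ∧ Reach H n x := by
  obtain ⟨y, hy, hyx⟩ := hx
  obtain ⟨f, f1, f2, f3, f4⟩ := polytope_flow H hy
  have hrow : ∀ u, ∑ w, r * f u w = x u := by
    intro u
    rw [← Finset.mul_sum, f3]
    exact congrFun hyx u
  obtain ⟨g, g1, g2, g3, g4⟩ := round_flow H _ (fun u w => r * f u w)
    (by intro u w; rw [f1 u w]; ring)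
    (by intro u w h; exact f2 u w (right_ne_zero_of_mul h))
    (by intro u; rw [hrow]; exact ⟨x u, rfl⟩) rfl
  have hnn : 0 ≤ ∑ u, ∑ w, |g u w| :=
    Finset.sum_nonneg fun u _ => Finset.sum_nonneg fun w _ => abs_nonneg _
  obtain ⟨s, hs⟩ := Int.eq_ofNat_of_zero_le hnn
  obtain ⟨n, hn, hR⟩ := Reach.of_flow H s g g1 g2 hs
  have hgx : (fun u => ∑ w, g u w) = x := by
    funext u
    have := (g3 u).trans (hrow u)
    exact_mod_cast this
  rw [hgx] at hR
  refine ⟨n, ?_, hR⟩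
  rw [hs] at g4
  have e : ∑ u, ∑ w, |r * f u w| = r * ∑ u, ∑ w, |f u w| := by
    simp only [abs_mul, abs_of_nonneg hr, Finset.mul_sum]
  change _ ≤ ∑ u, ∑ w, |r * f u w| at g4
  rw [e] at g4
  have : (s : ℝ) = 2 * n := by rw [← hn]; push_cast; ring
  push_cast at g4
  rw [this] at g4
  nlinarith

lemma zero_mem_polytope (H : SimpleGraph V) {a b : V} (hab : H.Adj a b) :
    (0 : V → ℝ) ∈ symEdgePolytope H := by
  have h1 : (Pi.single a (1 : ℝ) - Pi.single b 1 : V → ℝ) ∈ symEdgePolytope H :=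
    subset_convexHull _ _ ⟨a, b, hab, rfl⟩
  have h2 : (Pi.single b (1 : ℝ) - Pi.single a 1 : V → ℝ) ∈ symEdgePolytope H :=
    subset_convexHull _ _ ⟨b, a, hab.symm, rfl⟩
  have := (convex_convexHull ℝ _) h1 h2 (a := 1/2) (b := 1/2) (by norm_num) (by norm_num)
    (by norm_num)
  have e : (1 / 2 : ℝ) • (Pi.single a (1 : ℝ) - Pi.single b 1 : V → ℝ) +
      (1 / 2 : ℝ) • (Pi.single b (1 : ℝ) - Pi.single a 1 : V → ℝ) = 0 := by
    rw [← smul_add]; simp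
  rw [e] at this
  exact this

lemma mem_of_reach (H : SimpleGraph V) {a b : V} (hab : H.Adj a b) {n : ℕ} {x : V → ℤ}
    (h : Reach H n x) : toR x ∈ (n : ℝ) • symEdgePolytope H := by
  have hc : Convex ℝ (symEdgePolytope H) := convex_convexHull ℝ _
  induction h with
  | zero =>
    refine ⟨0, zero_mem_polytope H hab, ?_⟩
    ext u; simp [toR]
  | @step n x u w h hadj ih =>
    push_cast
    rw [hc.add_smul (Nat.cast_nonneg n) zero_le_one, one_smul]
    refine ⟨_, ih, Pi.single u (1 : ℝ) - Pi.single w 1, subset_convexHull _ _ ⟨u, w, hadj, rfl⟩, ?_⟩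
    ext t
    simp [toR, Pi.single_apply]

lemma polytope_mono (H : SimpleGraph V) {a b : V} (hab : H.Adj a b) {r s : ℝ} (hr : 0 ≤ r)
    (hrs : r ≤ s) : r • symEdgePolytope H ⊆ s • symEdgePolytope H := by
  have hc : Convex ℝ (symEdgePolytope H) := convex_convexHull ℝ _
  intro x hx
  have : s = r + (s - r) := by ring
  rw [this, hc.add_smul hr (by linarith)]
  exact ⟨x, hx, 0, ⟨0, zero_mem_polytope H hab, by simp⟩, by simp⟩

lemma count_eq (H : SimpleGraph V) {a b : V} (hab : H.Adj a b) (m : ℕ) :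
    latticePointCount (symEdgePolytope H) m =
      Nat.card {x : V → ℤ // ∃ n ≤ m, Reach H n x} := by
  unfold latticePointCount
  symm
  refine Nat.card_congr (Equiv.ofBijective (fun x => ⟨toR x.1, ?_, fun v => ⟨x.1 v, rfl⟩⟩) ⟨?_, ?_⟩)
  · obtain ⟨n, hn, h⟩ := x.2
    exact polytope_mono H hab (Nat.cast_nonneg n) (by exact_mod_cast hn) (mem_of_reach H hab h)
  · intro x y h
    have h' : toR x.1 = toR y.1 := congrArg Subtype.val h
    apply Subtype.ext
    funext u
    have := congrFun h' u
    simpa [toR] using this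
  · rintro ⟨x, hx, hz⟩
    choose z hz' using id hz
    have hzx : toR z = x := by funext u; exact (hz' u).symm
    obtain ⟨n, hn, h⟩ := reach_of_mem H (Nat.cast_nonneg m) (x := z) (by rw [hzx]; exact hx)
    exact ⟨⟨z, n, by exact_mod_cast hn, h⟩, Subtype.ext hzx⟩

/-- scaling -/
lemma reach_half (H : SimpleGraph V) {a b : V} (hab : H.Adj a b) {n : ℕ} {x : V → ℤ}
    (h : Reach H n (x + x)) : ∃ k : ℕ, 2 * k ≤ n ∧ Reach H k x := by
  obtain ⟨y, hy, hyx⟩ := mem_of_reach H hab h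
  have : toR x ∈ ((n : ℝ) / 2) • symEdgePolytope H := by
    refine ⟨y, hy, ?_⟩
    funext u
    have := congrFun hyx u
    simp [toR] at this ⊢
    linarith
  obtain ⟨k, hk, hr⟩ := reach_of_mem H (by positivity) this
  refine ⟨k, ?_, hr⟩
  have : (2 * k : ℝ) ≤ n := by linarith
  exact_mod_cast this

lemma count_induce (H : SimpleGraph V) (U : Set V) (hU : ∀ a b, H.Adj a b → a ∈ U ∧ b ∈ U) (m : ℕ) :
    latticePointCount (symEdgePolytope (H.induce U)) m =
      latticePointCount (symEdgePolytope H) m := by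
  classical
  let E : (U → ℝ) →ₗ[ℝ] (V → ℝ) := Function.ExtendByZero.linearMap ℝ (Subtype.val : U → V)
  have hEi : ∀ (x : U → ℝ) (u : U), E x u = x u := fun x u =>
    Subtype.val_injective.extend_apply _ _ _
  have hEo : ∀ (x : U → ℝ) (u : V), u ∉ U → E x u = 0 := fun x u hu =>
    Function.extend_apply' _ _ _ (by rintro ⟨a, rfl⟩; exact hu a.2)
  have hEs : ∀ u : U, E (Pi.single u 1) = Pi.single (u : V) 1 := by
    intro u
    funext t
    by_cases ht : t ∈ U
    · have := hEi (Pi.single u 1) ⟨t, ht⟩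
      simp only at this
      rw [this]
      simp only [Pi.single_apply, Subtype.ext_iff]
    · rw [hEo _ _ ht, Pi.single_apply, if_neg]
      rintro rfl; exact ht u.2
  have hP : E '' symEdgePolytope (H.induce U) = symEdgePolytope H := by
    unfold symEdgePolytope
    rw [E.image_convexHull]
    congr 1
    ext x
    constructor
    · rintro ⟨_, ⟨a, b, hab, rfl⟩, rfl⟩
      exact ⟨a, b, hab, by rw [map_sub, hEs, hEs]⟩
    · rintro ⟨a, b, hab, rfl⟩
      refine ⟨_, ⟨⟨a, (hU a b hab).1⟩, ⟨b, (hU a b hab).2⟩, hab, rfl⟩, ?_⟩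
      rw [map_sub, hEs, hEs]
  have hmP : E '' ((m : ℝ) • symEdgePolytope (H.induce U)) = (m : ℝ) • symEdgePolytope H := by
    rw [← hP, Set.image_smul_comm]
    intro b; exact map_smul E _ _
  unfold latticePointCount
  refine Nat.card_congr (Equiv.ofBijective (fun x => ⟨E x.1, ?_, ?_⟩) ⟨?_, ?_⟩)
  · rw [← hmP]; exact ⟨_, x.2.1, rfl⟩
  · intro v
    by_cases hv : v ∈ U
    · obtain ⟨z, hz⟩ := x.2.2 ⟨v, hv⟩
      exact ⟨z, (hEi x.1 ⟨v, hv⟩).trans hz⟩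
    · exact ⟨0, by rw [hEo _ _ hv]; simp⟩
  · intro x y h
    have h' : E x.1 = E y.1 := congrArg Subtype.val h
    apply Subtype.ext
    funext u
    rw [← hEi x.1, ← hEi y.1, h']
  · rintro ⟨x, hx, hz⟩
    rw [← hmP] at hx
    obtain ⟨y, hy, rfl⟩ := hx
    exact ⟨⟨y, hy, fun u => by rw [← hEi y]; exact hz u⟩, rfl⟩

lemma Reach.add {H : SimpleGraph V} {n m : ℕ} {x y : V → ℤ} (hx : Reach H n x) (hy : Reach H m y) :
    Reach H (n + m) (x + y) := by
  induction hy with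
  | zero => simpa using hx
  | step h hadj ih => rw [← add_assoc, ← add_assoc]; exact ih.step hadj

lemma Reach.mono {H K : SimpleGraph V} (hHK : H ≤ K) {n : ℕ} {x : V → ℤ} (hx : Reach H n x) :
    Reach K n x := by
  induction hx with
  | zero => exact Reach.zero
  | step h hadj ih => exact ih.step (hHK hadj)

lemma Reach.split {H K : SimpleGraph V} {n : ℕ} {x : V → ℤ} (hx : Reach (H ⊔ K) n x) :
    ∃ n1 n2 x1 x2, n1 + n2 = n ∧ x1 + x2 = x ∧ Reach H n1 x1 ∧ Reach K n2 x2 := by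
  induction hx with
  | zero => exact ⟨0, 0, 0, 0, rfl, by simp, Reach.zero, Reach.zero⟩
  | step h hadj ih =>
    obtain ⟨n1, n2, x1, x2, rfl, rfl, h1, h2⟩ := ih
    rcases hadj with hadj | hadj
    · exact ⟨n1 + 1, n2, _, x2, by omega, by abel, h1.step hadj, h2⟩
    · exact ⟨n1, n2 + 1, x1, _, by omega, by abel, h1, h2.step hadj⟩

lemma Reach.supp {H : SimpleGraph V} {U : Set V} (hU : ∀ a b, H.Adj a b → a ∈ U ∧ b ∈ U)
    {n : ℕ} {x : V → ℤ} (hx : Reach H n x) : ∀ u ∉ U, x u = 0 := by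
  induction hx with
  | zero => simp
  | @step n x a b h hadj ih =>
    intro u hu
    have h1 : u ≠ a := by rintro rfl; exact hu (hU _ _ hadj).1
    have h2 : u ≠ b := by rintro rfl; exact hu (hU _ _ hadj).2
    simp [ih u hu, h1, h2]

lemma Reach.sum_zero {H : SimpleGraph V} {n : ℕ} {x : V → ℤ} (hx : Reach H n x) :
    ∑ u, x u = 0 := by
  induction hx with
  | zero => simp
  | step h hadj ih => simp [Finset.sum_add_distrib, ih]

lemma Reach.parity {H : SimpleGraph V} (c : H.Coloring (Fin 2)) {n : ℕ} {x : V → ℤ}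
    (hx : Reach H n x) : (∑ u, x u * ((c u).val : ℤ)) % 2 = n % 2 := by
  induction hx with
  | zero => simp
  | @step n x a b h hadj ih =>
    have hne := c.valid hadj
    have : ∑ u, (x + (Pi.single a 1 - Pi.single b 1) : V → ℤ) u * ((c u).val : ℤ) =
        ∑ u, x u * ((c u).val : ℤ) + ((c a).val - (c b).val) := by
      simp [add_mul, sub_mul, Finset.sum_add_distrib, Pi.single_apply]
    rw [this]
    have h1 := (c a).isLt
    have h2 := (c b).isLt
    have h3 : (c a).val ≠ (c b).val := fun h => hne (Fin.ext h)
    push_cast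
    omega

lemma Reach.bound {H : SimpleGraph V} {n : ℕ} {x : V → ℤ} (hx : Reach H n x) (u : V) :
    |x u| ≤ n := by
  induction hx with
  | zero => simp
  | @step n x a b h hadj ih =>
    simp only [Pi.add_apply, Pi.sub_apply, Pi.single_apply]
    have := hadj.ne
    rw [abs_le] at ih ⊢
    push_cast
    split_ifs <;> omega

lemma reach_finite (H : SimpleGraph V) (n : ℕ) : {x : V → ℤ | Reach H n x}.Finite := by
  refine (Set.finite_Icc (fun _ => -(n : ℤ) : V → ℤ) (fun _ => (n : ℤ))).subset ?_
  intro x hx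
  exact ⟨fun u => (abs_le.1 (hx.bound u)).1, fun u => (abs_le.1 (hx.bound u)).2⟩

/-- lattice -/
def FLat (H : SimpleGraph V) : Set (V → ℤ) := {x | ∃ n, Reach H n x}

noncomputable def NN (H : SimpleGraph V) (x : V → ℤ) : ℕ := sInf {n | Reach H n x}

lemma NN_spec {H : SimpleGraph V} {x : V → ℤ} (hx : x ∈ FLat H) : Reach H (NN H x) x :=
  Nat.sInf_mem hx

lemma NN_le {H : SimpleGraph V} {n : ℕ} {x : V → ℤ} (hx : Reach H n x) : NN H x ≤ n :=
  Nat.sInf_le hx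

lemma Reach.lat {H : SimpleGraph V} {n : ℕ} {x : V → ℤ} (hx : Reach H n x) : x ∈ FLat H := ⟨n, hx⟩

lemma NN_add {H : SimpleGraph V} {x y : V → ℤ} (hx : x ∈ FLat H) (hy : y ∈ FLat H) :
    x + y ∈ FLat H ∧ NN H (x + y) ≤ NN H x + NN H y :=
  ⟨((NN_spec hx).add (NN_spec hy)).lat, NN_le ((NN_spec hx).add (NN_spec hy))⟩

def dd (v w : V) : V → ℤ := Pi.single v 1 - Pi.single w 1

lemma reach_dd {H : SimpleGraph V} {v w : V} (h : H.Adj v w) (k : ℤ) :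
    Reach H k.natAbs (k • dd v w) := by
  have hn : ∀ {v w : V}, H.Adj v w → ∀ n : ℕ, Reach H n ((n : ℤ) • dd v w) := by
    intro v w h n
    induction n with
    | zero => simpa using Reach.zero
    | succ n ih =>
      have := ih.step h
      push_cast
      rw [add_smul, one_smul]; exact this
  rcases Int.natAbs_eq k with hk | hk
  · have := hn h k.natAbs
    rwa [← hk] at this
  · have := hn h.symm k.natAbs
    have e : k • dd v w = (k.natAbs : ℤ) • dd w v := by
      have : dd w v = - dd v w := by simp [dd]
      rw [this, smul_neg, ← neg_smul, ← hk]
    rw [e]; exact this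

lemma lat_shift {H : SimpleGraph V} {v w : V} (h : H.Adj v w) {x : V → ℤ} (hx : x ∈ FLat H) (k : ℤ) :
    x + k • dd v w ∈ FLat H ∧ NN H (x + k • dd v w) ≤ NN H x + k.natAbs :=
  ⟨((NN_spec hx).add (reach_dd h k)).lat, NN_le ((NN_spec hx).add (reach_dd h k))⟩

/-- minimal elements of the classes mod `dd` -/
def BB (H : SimpleGraph V) (v w : V) : Set (V → ℤ) :=
  {x | x ∈ FLat H ∧ ∀ k : ℤ, NN H x ≤ NN H (x + k • dd v w)}

lemma NN_convex {H : SimpleGraph V} {v w : V} (h : H.Adj v w) {x : V → ℤ} (hx : x ∈ FLat H) (k : ℤ) :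
    2 * NN H (x + k • dd v w) ≤ NN H (x + (k + 1) • dd v w) + NN H (x + (k - 1) • dd v w) := by
  have h1 := NN_spec (lat_shift h hx (k + 1)).1
  have h2 := NN_spec (lat_shift h hx (k - 1)).1
  have h3 := h1.add h2
  have e : x + (k + 1) • dd v w + (x + (k - 1) • dd v w) =
      (x + k • dd v w) + (x + k • dd v w) := by
    simp only [add_smul, sub_smul]; abel
  rw [e] at h3
  obtain ⟨j, hj, hr⟩ := reach_half H h h3
  have := NN_le hr
  omega

lemma NN_ne {H : SimpleGraph V} {v w : V} (h : H.Adj v w) (hc : H.Colorable 2) {x : V → ℤ}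
    (hx : x ∈ FLat H) {k : ℤ} (hk : k.natAbs = 1) : NN H (x + k • dd v w) ≠ NN H x := by
  obtain ⟨c⟩ := hc
  have h1 := (NN_spec (lat_shift h hx k).1).parity c
  have h2 := ((NN_spec hx).add (reach_dd h k)).parity c
  rw [h1] at h2
  intro he
  rw [he] at h2
  omega

lemma NN_shift {H : SimpleGraph V} {v w : V} (h : H.Adj v w) (hc : H.Colorable 2) {x : V → ℤ}
    (hx : x ∈ BB H v w) (k : ℤ) : NN H (x + k • dd v w) = NN H x + k.natAbs := by
  obtain ⟨hL, hmin⟩ := hx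
  refine le_antisymm (lat_shift h hL k).2 ?_
  let g : ℤ → ℤ := fun k => NN H (x + k • dd v w)
  have hg : ∀ k, 2 * g k ≤ g (k + 1) + g (k - 1) := fun k => by
    have := NN_convex h hL k
    simp only [g]; exact_mod_cast this
  have g0 : g 0 = NN H x := by simp [g]
  have g1 : g 0 + 1 ≤ g 1 := by
    have := NN_ne h hc hL (k := 1) rfl
    have := hmin 1
    rw [g0]; simp only [g]; omega
  have g2 : g 0 + 1 ≤ g (-1) := by
    have := NN_ne h hc hL (k := -1) rfl
    have := hmin (-1)
    rw [g0]; simp only [g]; omega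
  have up : ∀ n : ℕ, g n + 1 ≤ g (n + 1) := by
    intro n
    induction n with
    | zero => simpa using g1
    | succ n ih =>
      have := hg (n + 1)
      push_cast
      rw [add_sub_cancel_right] at this
      omega
  have dn : ∀ n : ℕ, g (-n) + 1 ≤ g (-n - 1) := by
    intro n
    induction n with
    | zero => simpa using g2
    | succ n ih =>
      have := hg (-n - 1)
      push_cast
      rw [sub_add_cancel] at this
      have e : (-((n : ℤ) + 1)) = -n - 1 := by ring
      rw [e]
      omega
  have up' : ∀ n : ℕ, g 0 + n ≤ g n := by
    intro n
    induction n with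
    | zero => simp
    | succ n ih => have := up n; push_cast; omega
  have dn' : ∀ n : ℕ, g 0 + n ≤ g (-n) := by
    intro n
    induction n with
    | zero => simp
    | succ n ih =>
      have := dn n
      push_cast
      have e : (-((n : ℤ) + 1)) = -n - 1 := by ring
      rw [e]; omega
  have : g 0 + k.natAbs ≤ g k := by
    rcases Int.natAbs_eq k with hk | hk
    · have := up' k.natAbs
      have e : g k = g k.natAbs := congrArg g hk
      rw [e]; exact this
    · have := dn' k.natAbs
      have e : g k = g (-k.natAbs) := congrArg g hk
      rw [e]; exact this
  rw [g0] at this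
  simp only [g] at this
  exact_mod_cast this

lemma exists_BB {H : SimpleGraph V} {v w : V} (h : H.Adj v w) {x : V → ℤ}
    (hx : x ∈ FLat H) : ∃ k : ℤ, x + k • dd v w ∈ BB H v w := by
  let k := Function.argmin (fun k : ℤ => NN H (x + k • dd v w))
  refine ⟨k, (lat_shift h hx k).1, fun j => ?_⟩
  rw [add_assoc, ← add_smul]
  exact Function.argmin_le (fun k : ℤ => NN H (x + k • dd v w)) (k + j)

end flows

section gfs

noncomputable def gf {X : Type*} (N : X → ℕ) : PowerSeries ℚ :=
  PowerSeries.mk fun n => (Nat.card {x // N x = n} : ℚ)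

lemma gf_congr {X Y : Type*} {N : X → ℕ} {M : Y → ℕ} (e : X ≃ Y) (h : ∀ x, M (e x) = N x) :
    gf N = gf M := by
  unfold gf
  congr 1
  funext n
  congr 1
  exact Nat.card_congr (e.subtypeEquiv fun x => by rw [h])

lemma gf_mul {X Y : Type*} (N : X → ℕ) (M : Y → ℕ) (hN : ∀ n, Finite {x // N x = n})
    (hM : ∀ n, Finite {y // M y = n}) :
    gf (fun p : X × Y => N p.1 + M p.2) = gf N * gf M := by
  ext n
  rw [PowerSeries.coeff_mul]
  simp only [gf, PowerSeries.coeff_mk]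
  let e : {p : X × Y // N p.1 + M p.2 = n} ≃
      Σ q : Finset.HasAntidiagonal.antidiagonal n, {x // N x = q.1.1} × {y // M y = q.1.2} :=
    { toFun := fun p => ⟨⟨(N p.1.1, M p.1.2), by simpa using p.2⟩, ⟨p.1.1, rfl⟩, ⟨p.1.2, rfl⟩⟩
      invFun := fun s => ⟨(s.2.1.1, s.2.2.1), by
        have := Finset.HasAntidiagonal.mem_antidiagonal.1 s.1.2
        rw [s.2.1.2, s.2.2.2]; exact this⟩
      left_inv := fun p => rfl
      right_inv := by
        rintro ⟨⟨⟨a, b⟩, hq⟩, ⟨x, hx⟩, ⟨y, hy⟩⟩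
        dsimp only at hx hy
        subst hx hy
        rfl }
  rw [Nat.card_congr e, Nat.card_sigma]
  simp only [Nat.card_prod]
  push_cast
  rw [Finset.sum_coe_sort (Finset.HasAntidiagonal.antidiagonal n)
    (fun q => (Nat.card {x // N x = q.1} : ℚ) * (Nat.card {y // M y = q.2} : ℚ))]

lemma gf_id : gf (fun n : ℕ => n) * (1 - PowerSeries.X) = 1 := by
  have : gf (fun n : ℕ => n) = PowerSeries.mk 1 := by
    unfold gf
    congr 1
    funext n
    simp
  rw [this, PowerSeries.mk_one_mul_one_sub_eq_one]

lemma gf_le {X : Type*} (N : X → ℕ) (hN : ∀ n, Finite {x // N x = n}) :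
    PowerSeries.mk (fun m => (Nat.card {x // N x ≤ m} : ℚ)) = gf N * gf (fun n : ℕ => n) := by
  rw [← gf_mul N _ hN (fun n => by infer_instance)]
  unfold gf
  congr 1
  funext m
  congr 1
  exact Nat.card_congr
    { toFun := fun x => ⟨(x.1, m - N x.1), by have := x.2; simp only; omega⟩
      invFun := fun p => ⟨p.1.1, by have := p.2; dsimp only at this; omega⟩
      left_inv := fun x => rfl
      right_inv := by
        rintro ⟨⟨x, j⟩, h⟩
        dsimp only at h
        ext1
        ext1
        · rfl
        · dsimp only; omega }

lemma card_natAbs (n : ℕ) : Nat.card {k : ℤ // k.natAbs = n} = if n = 0 then 1 else 2 := by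
  have : {k : ℤ | k.natAbs = n} = (({(n : ℤ), -(n : ℤ)} : Finset ℤ) : Set ℤ) := by
    ext k
    simp
    omega
  have h2 : Nat.card {k : ℤ // k.natAbs = n} = Set.ncard {k : ℤ | k.natAbs = n} := rfl
  rw [h2, this, Set.ncard_coe_finset]
  split_ifs with h
  · simp [h]
  · rw [Finset.card_pair]; omega

lemma gf_int : gf Int.natAbs * (1 - PowerSeries.X) = 1 + PowerSeries.X := by
  have : gf Int.natAbs = 2 * PowerSeries.mk 1 - 1 := by
    ext n
    have h2 : (2 : PowerSeries ℚ) = PowerSeries.C 2 := (map_ofNat PowerSeries.C 2).symm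
    rw [h2, map_sub, PowerSeries.coeff_C_mul]
    simp only [gf, PowerSeries.coeff_mk, card_natAbs, PowerSeries.coeff_one]
    split_ifs <;> norm_num
  rw [this, sub_mul, mul_assoc, PowerSeries.mk_one_mul_one_sub_eq_one]
  ring

end gfs

section final
variable {V : Type*} [Fintype V] [DecidableEq V]

lemma NN_fin (H : SimpleGraph V) (n : ℕ) : Finite {x : FLat H // NN H x.1 = n} := by
  have := (reach_finite H n).to_subtype
  refine Finite.of_injective (β := {x : V → ℤ | Reach H n x})
    (fun x => ⟨x.1.1, by have := NN_spec x.1.2; rw [x.2] at this; exact this⟩) ?_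
  intro x y h
  apply Subtype.ext
  apply Subtype.ext
  exact congrArg (fun t : {x : V → ℤ | Reach H n x} => t.1) h

lemma BB_fin (H : SimpleGraph V) (v w : V) (n : ℕ) :
    Finite {x : BB H v w // NN H x.1 = n} := by
  have := NN_fin H n
  refine Finite.of_injective (β := {x : FLat H // NN H x.1 = n})
    (fun x => ⟨⟨x.1.1, x.1.2.1⟩, x.2⟩) ?_
  intro x y h
  apply Subtype.ext
  apply Subtype.ext
  exact congrArg (fun t => t.1.1) h

lemma ehr_eq (H : SimpleGraph V) {a b : V} (hab : H.Adj a b) :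
    PowerSeries.mk (fun m => (latticePointCount (symEdgePolytope H) m : ℚ)) =
      gf (fun x : FLat H => NN H x.1) * gf (fun n : ℕ => n) := by
  rw [← gf_le _ (NN_fin H)]
  congr 1
  funext m
  congr 1
  rw [count_eq H hab]
  exact Nat.card_congr
    { toFun := fun x => ⟨⟨x.1, by obtain ⟨n, _, h⟩ := x.2; exact h.lat⟩, by
        obtain ⟨n, hn, h⟩ := x.2; exact (NN_le h).trans hn⟩
      invFun := fun x => ⟨x.1.1, NN H x.1.1, x.2, NN_spec x.1.2⟩
      left_inv := fun x => rfl
      right_inv := fun x => rfl }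

lemma gf_two {H : SimpleGraph V} {v w : V} (h : H.Adj v w) (hc : H.Colorable 2) :
    gf (fun x : FLat H => NN H x.1) = gf (fun x : BB H v w => NN H x.1) * gf Int.natAbs := by
  rw [← gf_mul _ _ (BB_fin H v w) (fun n => by
    apply Nat.finite_of_card_ne_zero
    rw [card_natAbs]; split_ifs <;> simp)]
  symm
  refine gf_congr (Equiv.ofBijective
    (fun p : BB H v w × ℤ => (⟨p.1.1 + p.2 • dd v w, (lat_shift h p.1.2.1 p.2).1⟩ : FLat H))
    ⟨?_, ?_⟩) ?_
  · rintro ⟨⟨x, hx⟩, k⟩ ⟨⟨y, hy⟩, j⟩ hxy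
    have e : x + k • dd v w = y + j • dd v w := congrArg Subtype.val hxy
    have e1 : y = x + (k - j) • dd v w := by
      rw [sub_smul, ← add_sub_assoc, e]; abel
    have e2 : x = y + (j - k) • dd v w := by
      rw [sub_smul, ← add_sub_assoc, ← e]; abel
    have h1 := NN_shift h hc hx (k - j)
    have h2 := NN_shift h hc hy (j - k)
    rw [← e1] at h1
    rw [← e2] at h2
    have : k = j := by omega
    subst this
    have : x = y := by simpa using e
    subst this
    rfl
  · rintro ⟨x, hx⟩
    obtain ⟨k, hk⟩ := exists_BB h hx
    refine ⟨(⟨_, hk⟩, -k), Subtype.ext ?_⟩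
    simp
  · rintro ⟨⟨x, hx⟩, k⟩
    exact NN_shift h hc hx k

lemma overlap {G1 G2 : SimpleGraph V} {V1 V2 : Set V} {v w : V} (hvw : v ≠ w)
    (hinter : V1 ∩ V2 = {v, w})
    (hE1 : ∀ a b, G1.Adj a b → a ∈ V1 ∧ b ∈ V1)
    (hE2 : ∀ a b, G2.Adj a b → a ∈ V2 ∧ b ∈ V2)
    {x x' y y' : V → ℤ} (hx : x ∈ FLat G1) (hx' : x' ∈ FLat G1) (hy : y ∈ FLat G2)
    (hy' : y' ∈ FLat G2) (h : x + y = x' + y') :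
    ∃ k : ℤ, x = x' + k • dd v w ∧ y' = y + k • dd v w := by
  have hd : x - x' = y' - y := by
    rw [sub_eq_sub_iff_add_eq_add, h]; abel
  have hout : ∀ u, u ≠ v → u ≠ w → (x - x') u = 0 := by
    intro u h1 h2
    by_cases hu : u ∈ V1
    · have hu2 : u ∉ V2 := by
        intro hu2
        have : u ∈ V1 ∩ V2 := ⟨hu, hu2⟩
        rw [hinter] at this
        rcases this with rfl | rfl
        · exact h1 rfl
        · exact h2 rfl
      rw [hd]
      simp [(NN_spec hy).supp hE2 u hu2, (NN_spec hy').supp hE2 u hu2]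
    · simp [(NN_spec hx).supp hE1 u hu, (NN_spec hx').supp hE1 u hu]
  have hsum : ∑ u, (x - x') u = 0 := by
    simp [(NN_spec hx).sum_zero, (NN_spec hx').sum_zero]
  have hsum2 : (x - x') v + (x - x') w = 0 := by
    rw [← Finset.sum_pair hvw, ← hsum]
    apply Finset.sum_subset (Finset.subset_univ _)
    intro u _ hu
    simp at hu
    exact hout u hu.1 hu.2
  have key : x - x' = ((x - x') v) • dd v w := by
    funext u
    by_cases h1 : u = v
    · subst h1; simp [dd, hvw]
    · by_cases h2 : u = w
      · subst h2
        simp [dd, h1] at hsum2 ⊢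
        linarith
      · rw [hout u h1 h2]; simp [dd, h1, h2]
  refine ⟨(x - x') v, ?_, ?_⟩
  · rw [← key]; abel
  · rw [← key, hd]; abel

lemma gf_sup {G1 G2 : SimpleGraph V} {V1 V2 : Set V} {v w : V} (hvw : v ≠ w)
    (hinter : V1 ∩ V2 = {v, w})
    (hE1 : ∀ a b, G1.Adj a b → a ∈ V1 ∧ b ∈ V1)
    (hE2 : ∀ a b, G2.Adj a b → a ∈ V2 ∧ b ∈ V2)
    (hvw1 : G1.Adj v w) (hvw2 : G2.Adj v w) (hbip2 : G2.Colorable 2) :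
    gf (fun x : FLat (G1 ⊔ G2) => NN (G1 ⊔ G2) x.1) =
      gf (fun x : FLat G1 => NN G1 x.1) * gf (fun x : BB G2 v w => NN G2 x.1) := by
  rw [← gf_mul _ _ (NN_fin G1) (BB_fin G2 v w)]
  symm
  have hR : ∀ x ∈ FLat G1, ∀ y ∈ FLat G2, Reach (G1 ⊔ G2) (NN G1 x + NN G2 y) (x + y) :=
    fun x hx y hy => ((NN_spec hx).mono le_sup_left).add ((NN_spec hy).mono le_sup_right)
  refine gf_congr (Equiv.ofBijective
    (fun p : FLat G1 × BB G2 v w =>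
      (⟨p.1.1 + p.2.1, (hR _ p.1.2 _ p.2.2.1).lat⟩ : FLat (G1 ⊔ G2))) ⟨?_, ?_⟩) ?_
  · rintro ⟨⟨x, hx⟩, ⟨y, hy⟩⟩ ⟨⟨x', hx'⟩, ⟨y', hy'⟩⟩ hxy
    have e : x + y = x' + y' := congrArg Subtype.val hxy
    obtain ⟨k, hk1, hk2⟩ := overlap hvw hinter hE1 hE2 hx hx' hy.1 hy'.1 e
    have h1 := NN_shift hvw2 hbip2 hy k
    rw [← hk2] at h1
    have h2 := NN_shift hvw2 hbip2 hy' (-k)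
    have e2 : y' + (-k) • dd v w = y := by rw [hk2]; simp
    rw [e2] at h2
    have : k = 0 := by omega
    subst this
    simp at hk1 hk2
    subst hk1 hk2
    rfl
  · rintro ⟨x, n, hx⟩
    obtain ⟨n1, n2, x1, x2, -, rfl, h1, h2⟩ := hx.split
    obtain ⟨k, hk⟩ := exists_BB hvw2 h2.lat
    refine ⟨(⟨x1 + (-k) • dd v w, (lat_shift hvw1 h1.lat _).1⟩, ⟨_, hk⟩), Subtype.ext ?_⟩
    simp
    abel
  · rintro ⟨⟨x, hx⟩, ⟨y, hy⟩⟩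
    refine le_antisymm (NN_le (hR x hx y hy.1)) ?_
    have hr := NN_spec (hR x hx y hy.1).lat
    obtain ⟨n1, n2, x', y', hn, e, h1, h2⟩ := hr.split
    obtain ⟨k, hk1, hk2⟩ := overlap hvw hinter hE1 hE2 hx h1.lat hy.1 h2.lat e.symm
    have a1 := NN_shift hvw2 hbip2 hy k
    rw [← hk2] at a1
    have a2 := (lat_shift hvw1 h1.lat k).2
    rw [← hk1] at a2
    have a3 := NN_le h1
    have a4 := NN_le h2
    change NN G1 x + NN G2 y ≤ NN (G1 ⊔ G2) (x + y)
    omega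

end final

lemma count_series_induce {V : Type*} [Fintype V] [DecidableEq V] (H : SimpleGraph V) (U : Set V)
    (hU : ∀ a b, H.Adj a b → a ∈ U ∧ b ∈ U) [DecidableEq U] :
    PowerSeries.mk (fun m => (latticePointCount (symEdgePolytope (H.induce U)) m : ℚ)) =
      PowerSeries.mk (fun m => (latticePointCount (symEdgePolytope H) m : ℚ)) := by
  congr 1
  funext m
  rw [← count_induce H U hU m]
  congr!

/-- Let `G1` (on `V1`, connected) and `G2` (on `V2`, connected and
bipartite) be finite simple graphs sharing exactly the edge `{v, w}` with its two
endpoints, and let `G = G1 ∪ G2`. Then the Ehrhart series of the symmetric edge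
polytopes satisfy `(1+t)·Ehr_G(t) = (1−t)²·Ehr_{G1}(t)·Ehr_{G2}(t)` in `ℚ[[t]]`,
i.e. the `h*`-polynomial of `P_G` is the product of those of `P_{G1}` and `P_{G2}`
divided by `(1+t)`. -/
theorem stmt9 {V : Type*} [Fintype V] [DecidableEq V]
    (G1 G2 : SimpleGraph V) (V1 V2 : Set V) (v w : V) (hvw : v ≠ w)
    (hcover : V1 ∪ V2 = Set.univ)
    (hinter : V1 ∩ V2 = {v, w})
    (hE1 : ∀ a b, G1.Adj a b → a ∈ V1 ∧ b ∈ V1)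
    (hE2 : ∀ a b, G2.Adj a b → a ∈ V2 ∧ b ∈ V2)
    (hvw1 : G1.Adj v w) (hvw2 : G2.Adj v w)
    (hEinter : ∀ a b, G1.Adj a b → G2.Adj a b → (a = v ∧ b = w) ∨ (a = w ∧ b = v))
    (hconn1 : (G1.induce V1).Connected) (hconn2 : (G2.induce V2).Connected)
    (hbip2 : G2.Colorable 2) :
    (1 + PowerSeries.X : PowerSeries ℚ) *
        PowerSeries.mk (fun m => (latticePointCount (symEdgePolytope (G1 ⊔ G2)) m : ℚ)) =
      (1 - PowerSeries.X : PowerSeries ℚ) ^ 2 *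
        PowerSeries.mk (fun m => (latticePointCount (symEdgePolytope (G1.induce V1)) m : ℚ)) *
        PowerSeries.mk (fun m => (latticePointCount (symEdgePolytope (G2.induce V2)) m : ℚ)) := by
  rw [count_series_induce G1 V1 hE1, count_series_induce G2 V2 hE2,
    ehr_eq G1 hvw1, ehr_eq G2 hvw2, ehr_eq (G1 ⊔ G2) (Or.inl hvw1),
    gf_sup hvw hinter hE1 hE2 hvw1 hvw2 hbip2, gf_two hvw2 hbip2]
  have hi := gf_id
  have hz := gf_int
  rw [← hz]
  linear_combination (-(gf fun x : FLat G1 => NN G1 x.1) *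
    (gf fun x : BB G2 v w => NN G2 x.1) * gf Int.natAbs * (1 - PowerSeries.X) *
    (gf fun n : ℕ => n)) * hi
end

section
/- Let i, j ≥ 1 and let G be a graph obtained from two odd cycles C and C' of lengths 2i+1 and 2j+1 by identifying one edge of C (together with its two endpoints) with one edge of C'; thus G has 2i + 2j vertices. Then lim_{m→∞} #(m·P_G ∩ ℤ^{V(G)}) / m^{2i+2j−1} = (i + j + 2ij)·C(2i,i)·C(2j,j) / (2i+2j−1)!. (Equivalently, the normalized volume of P_G equals (i + j + 2ij)·C(2i,i)·C(2j,j).) -/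
open SimpleGraph Pointwise

theorem th_card_le {ι : Type*} [Fintype ι] (m : ℕ) :
    Finite {h : ι → ℕ // ∑ i, h i ≤ m} ∧
    Nat.card {h : ι → ℕ // ∑ i, h i ≤ m} = (m + Fintype.card ι).choose (Fintype.card ι) := by
  classical
  let e1 : {h : ι → ℕ // ∑ i, h i ≤ m} ≃ {P : Option ι → ℕ // ∑ i, P i = m} :=
    { toFun := fun h => ⟨fun o => o.elim (m - ∑ i, h.1 i) h.1, by
        have := h.2
        simp [Fintype.sum_option]; omega⟩
      invFun := fun P => ⟨fun i => P.1 (some i), by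
        have := P.2
        rw [Fintype.sum_option] at this
        change ∑ i, P.1 (some i) ≤ m
        omega⟩
      left_inv := fun h => by ext i; rfl
      right_inv := fun P => by
        have := P.2
        simp [Fintype.sum_option] at this
        ext o
        cases o with
        | none => simp; omega
        | some i => rfl }
  let e2 := e1.trans (Sym.equivNatSumOfFintype (Option ι) m).symm
  refine ⟨Finite.of_equiv _ e2.symm, ?_⟩
  rw [Nat.card_congr e2, Nat.card_eq_fintype_card, Sym.card_sym_eq_choose, Fintype.card_option]
  rw [show Fintype.card ι + 1 + m - 1 = m + Fintype.card ι by omega, Nat.choose_symm_add]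

theorem th_squeeze {E K β : Type*} [Fintype E] [Fintype K] (σ : K → E → ℝ) (d : ℕ)
    (hd : ∀ κ, Nat.card {e // σ κ e ≠ 0} = d) (X : ℕ → Set β) (D : (E → ℝ) → β)
    (hU : ∀ m x, x ∈ X m → ∃ κ, ∃ g : E → ℕ, (∀ e, σ κ e = 0 → g e = 0) ∧ ∑ e, g e ≤ m ∧
      D (fun e => σ κ e * g e) = x)
    (hL : ∀ m, 0 < m → ∀ κ, ∀ g : E → ℕ, ∑ e, g e ≤ m → D (fun e => σ κ e * g e) ∈ X m)
    (hI : ∀ κ κ', ∀ g g' : E → ℕ, (∀ e, σ κ e = 0 ↔ g e = 0) → (∀ e, σ κ' e = 0 ↔ g' e = 0) →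
      D (fun e => σ κ e * g e) = D (fun e => σ κ' e * g' e) → κ = κ' ∧ g = g') :
    Filter.Tendsto (fun m : ℕ => (Nat.card (X m) : ℝ) / (m : ℝ) ^ d) Filter.atTop
      (nhds ((Fintype.card K : ℝ) / (Nat.factorial d : ℝ))) := by
  classical
  have hd' : ∀ κ, Fintype.card {e // σ κ e ≠ 0} = d := fun κ => by
    rw [← Nat.card_eq_fintype_card]; exact hd κ
  let T : ℕ → Type _ := fun m => Σ κ : K, {h : {e // σ κ e ≠ 0} → ℕ // ∑ i, h i ≤ m}
  have hfin : ∀ m, ∀ κ : K, Finite {h : {e // σ κ e ≠ 0} → ℕ // ∑ i, h i ≤ m} :=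
    fun m κ => (th_card_le m).1
  have hTfin : ∀ m, Finite (T m) := fun m => inferInstance
  have hTcard : ∀ m, Nat.card (T m) = Fintype.card K * (m + d).choose d := by
    intro m
    simp only [T]
    rw [Nat.card_sigma]
    simp [(th_card_le m).2, hd']
  let ext : ∀ κ : K, ({e // σ κ e ≠ 0} → ℕ) → E → ℕ := fun κ h e =>
    if he : σ κ e ≠ 0 then h ⟨e, he⟩ else 0
  have hext : ∀ κ h, ∑ e, ext κ h e = ∑ i, h i := by
    intro κ h
    rw [← Fintype.sum_subtype_add_sum_subtype (fun e => σ κ e ≠ 0)]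
    have h1 : ∀ i : {e // σ κ e ≠ 0}, ext κ h i.1 = h i := fun i => by simp [ext, i.2]
    have h2 : ∀ i : {e // ¬ σ κ e ≠ 0}, ext κ h i.1 = 0 := fun i => dif_neg i.2
    simp [h1, h2]
  have hup : ∀ m, Finite (X m) ∧ Nat.card (X m) ≤ Fintype.card K * (m + d).choose d := by
    intro m
    have key : ∀ x : X m, ∃ t : T m, D (fun e => σ t.1 e * ext t.1 t.2.1 e) = x.1 := by
      rintro ⟨x, hx⟩
      obtain ⟨κ, g, h0, hs, hD⟩ := hU m x hx
      have : ext κ (fun i => g i.1) = g := by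
        funext e
        simp only [ext]
        split_ifs with h
        · rfl
        · exact (h0 e (not_not.1 h)).symm
      refine ⟨⟨κ, ⟨fun i => g i.1, ?_⟩⟩, ?_⟩
      · rw [← hext, this]; exact hs
      · simp only [this]; exact hD
    choose F hF using key
    have hFi : Function.Injective F := by
      intro x y hxy
      apply Subtype.ext
      rw [← hF x, ← hF y, hxy]
    have := hTfin m
    exact ⟨Finite.of_injective F hFi, (hTcard m) ▸ Nat.card_le_card_of_injective F hFi⟩
  have hlow : ∀ m, 0 < m → d ≤ m → Fintype.card K * m.choose d ≤ Nat.card (X m) := by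
    intro m hm hdm
    have h1 : ∀ t : T (m - d), ∑ e, ext t.1 (fun i => t.2.1 i + 1) e ≤ m := by
      rintro ⟨κ, h, hh⟩
      refine (hext κ (fun i => h i + 1)).trans_le ?_
      simp only [Finset.sum_add_distrib, Finset.sum_const, Finset.card_univ, hd']
      have h5 := hh
      rw [smul_eq_mul, mul_one]
      refine (Nat.add_le_add_right h5 d).trans ?_
      omega
    let F : T (m - d) → X m := fun t => ⟨D (fun e => σ t.1 e * ext t.1 (fun i => t.2.1 i + 1) e),
      hL m hm _ _ (h1 t)⟩
    have hFi : Function.Injective F := by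
      rintro ⟨κ, h, hh⟩ ⟨κ', h', hh'⟩ hF
      have h2 := hI κ κ' (ext κ (fun i => h i + 1)) (ext κ' (fun i => h' i + 1))
        (fun e => by simp [ext]) (fun e => by simp [ext]) (congrArg Subtype.val hF)
      obtain ⟨rfl, h3⟩ := h2
      congr 2
      funext i
      have := congrFun h3 i.1
      simp only [ext, i.2, dif_pos, ne_eq, not_false_eq_true] at this
      simpa using this
    have := (hup m).1
    have h4 := Nat.card_le_card_of_injective F hFi
    rwa [hTcard, Nat.sub_add_cancel hdm] at h4
  have hdpos : (0:ℝ) < d.factorial := by positivity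
  have lim1 : Filter.Tendsto (fun m : ℕ => (Fintype.card K : ℝ) / d.factorial *
      ((1 : ℝ) + (d:ℝ) / m) ^ d) Filter.atTop (nhds ((Fintype.card K : ℝ) / d.factorial)) := by
    have : Filter.Tendsto (fun m : ℕ => (d:ℝ) / m) Filter.atTop (nhds 0) :=
      tendsto_const_div_atTop_nhds_zero_nat _
    simpa using ((this.const_add 1).pow d).const_mul ((Fintype.card K : ℝ) / d.factorial)
  have lim2 : Filter.Tendsto (fun m : ℕ => (Fintype.card K : ℝ) / d.factorial *
      ((1 : ℝ) - (d:ℝ) / m) ^ d) Filter.atTop (nhds ((Fintype.card K : ℝ) / d.factorial)) := by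
    have : Filter.Tendsto (fun m : ℕ => (d:ℝ) / m) Filter.atTop (nhds 0) :=
      tendsto_const_div_atTop_nhds_zero_nat _
    simpa using ((this.const_sub 1).pow d).const_mul ((Fintype.card K : ℝ) / d.factorial)
  refine tendsto_of_tendsto_of_tendsto_of_le_of_le' lim2 lim1 ?_ ?_
  · filter_upwards [Filter.eventually_ge_atTop (d + 1)] with m hm
    have hm0 : (0:ℝ) < m := by exact_mod_cast (by omega : 0 < m)
    rw [le_div_iff₀ (by positivity)]
    have h1 : (Fintype.card K : ℝ) * m.choose d ≤ Nat.card (X m) := by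
      exact_mod_cast hlow m (by omega) (by omega)
    refine le_trans ?_ h1
    have h2 := Nat.pow_le_choose (α := ℝ) d m
    have h3 : ((m:ℝ) - d) ^ d ≤ ((m + 1 - d : ℕ) : ℝ) ^ d := by
      have : (d:ℝ) + 1 ≤ m := by exact_mod_cast hm
      apply pow_le_pow_left₀ (by linarith)
      rw [Nat.cast_sub (by omega)]; push_cast; linarith
    have h4 : (1 - (d:ℝ) / m) ^ d * (m:ℝ) ^ d = ((m:ℝ) - d) ^ d := by
      rw [← mul_pow]; congr 1; field_simp
    calc _ = (Fintype.card K : ℝ) * (((m:ℝ) - d) ^ d / d.factorial) := by rw [← h4]; ring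
      _ ≤ (Fintype.card K : ℝ) * m.choose d := by
        gcongr
        refine le_trans ?_ h2
        gcongr
  · filter_upwards [Filter.eventually_ge_atTop (d + 1)] with m hm
    have hm0 : (0:ℝ) < m := by exact_mod_cast (by omega : 0 < m)
    rw [div_le_iff₀ (by positivity)]
    have h1 : (Nat.card (X m) : ℝ) ≤ (Fintype.card K : ℝ) * (m + d).choose d := by
      exact_mod_cast (hup m).2
    refine h1.trans ?_
    have h2 := Nat.choose_le_pow_div (α := ℝ) d (m + d)
    have h4 : (1 + (d:ℝ) / m) ^ d * (m:ℝ) ^ d = ((m + d : ℕ):ℝ) ^ d := by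
      rw [← mul_pow]; congr 1; push_cast; field_simp
    calc _ ≤ (Fintype.card K : ℝ) * (((m + d : ℕ):ℝ) ^ d / d.factorial) := by gcongr
      _ = _ := by rw [← h4]; ring

abbrev ThB (i : ℕ) : Type := {P : Finset (Fin (2 * i)) // P.card = i}
abbrev ThU (i : ℕ) : Type := Σ P : ThB i, {k : Fin (2 * i) // k ∉ P.1}
abbrev ThD (i : ℕ) : Type := Σ P : ThB i, {k : Fin (2 * i) // k ∈ P.1}
abbrev ThK (i j : ℕ) : Type :=
  (ThU i × ThU j) ⊕ (ThD i × ThD j) ⊕ (ThD i × ThB j) ⊕ (ThB i × ThU j)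
abbrev ThE (i j : ℕ) : Type := Option (Fin (2 * i) ⊕ Fin (2 * j))

theorem th_cardB (i : ℕ) : Fintype.card (ThB i) = (2 * i).choose i := by
  simp [ThB]

theorem th_cardU (i : ℕ) : Fintype.card (ThU i) = (2 * i).choose i * i := by
  rw [Fintype.card_sigma]
  have : ∀ P : ThB i, Fintype.card {k : Fin (2 * i) // k ∉ P.1} = i := by
    intro P
    rw [Fintype.card_subtype_compl, Fintype.card_coe, P.2, Fintype.card_fin]; omega
  simp [this]

theorem th_cardD (i : ℕ) : Fintype.card (ThD i) = (2 * i).choose i * i := by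
  rw [Fintype.card_sigma]
  have : ∀ P : ThB i, Fintype.card {k : Fin (2 * i) // k ∈ P.1} = i := by
    intro P
    rw [Fintype.card_coe, P.2]
  simp [this]

theorem th_cardK (i j : ℕ) : Fintype.card (ThK i j) =
    (i + j + 2 * i * j) * (2 * i).choose i * (2 * j).choose j := by
  simp only [ThK, Fintype.card_sum, Fintype.card_prod, th_cardB, th_cardU, th_cardD]
  ring

noncomputable def sB {n : ℕ} (P : Finset (Fin n)) (k : Fin n) : ℝ := if k ∈ P then 1 else -1
noncomputable def sZ {n : ℕ} (P : Finset (Fin n)) (z k : Fin n) : ℝ := if k = z then 0 else sB P k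

def el3 {n n' : ℕ} (a : ℝ) (b : Fin n → ℝ) (c : Fin n' → ℝ) : Option (Fin n ⊕ Fin n') → ℝ :=
  fun o => o.elim a (Sum.elim b c)

noncomputable def thS {i j : ℕ} : ThK i j → ThE i j → ℝ
  | .inl (u, u') => el3 1 (sZ u.1.1 u.2.1) (sZ u'.1.1 u'.2.1)
  | .inr (.inl (u, u')) => el3 (-1) (sZ u.1.1 u.2.1) (sZ u'.1.1 u'.2.1)
  | .inr (.inr (.inl (u, u'))) => el3 0 (sZ u.1.1 u.2.1) (sB u'.1)
  | .inr (.inr (.inr (u, u'))) => el3 0 (sB u.1) (sZ u'.1.1 u'.2.1)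

theorem sB_ne {n : ℕ} (P : Finset (Fin n)) (k : Fin n) : sB P k ≠ 0 := by
  unfold sB; split_ifs <;> norm_num

theorem sB_vals {n : ℕ} (P : Finset (Fin n)) (k : Fin n) :
    sB P k = -1 ∨ sB P k = 0 ∨ sB P k = 1 := by
  unfold sB; split_ifs <;> norm_num

theorem sZ_eq {n : ℕ} (P : Finset (Fin n)) (z k : Fin n) : sZ P z k = 0 ↔ k = z := by
  unfold sZ; split_ifs with h <;> simp [h, sB_ne]

theorem sZ_vals {n : ℕ} (P : Finset (Fin n)) (z k : Fin n) :
    sZ P z k = -1 ∨ sZ P z k = 0 ∨ sZ P z k = 1 := by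
  unfold sZ; split_ifs
  · simp
  · exact sB_vals P k

theorem thS_vals {i j : ℕ} (κ : ThK i j) (e : ThE i j) :
    thS κ e = -1 ∨ thS κ e = 0 ∨ thS κ e = 1 := by
  rcases κ with κ | κ | κ | κ <;> rcases e with _ | e | e <;>
    simp [thS, el3, sB_vals, sZ_vals]

theorem th_supp {i j : ℕ} (hi : 1 ≤ i) (hj : 1 ≤ j) (κ : ThK i j) :
    Nat.card {e // thS κ e ≠ 0} = 2 * i + 2 * j - 1 := by
  classical
  rw [Nat.card_eq_fintype_card, Fintype.card_subtype, Finset.card_filter, Fintype.sum_option,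
    Fintype.sum_sum_type]
  have hZ : ∀ n (z : Fin n), (∑ k : Fin n, if k = z then 0 else 1) = n - 1 := by
    intro n z
    have h : (∑ k : Fin n, if k = z then 0 else 1) = ∑ k : Fin n, if k ≠ z then 1 else 0 :=
      Finset.sum_congr rfl (fun k _ => by by_cases h : k = z <;> simp [h])
    rw [h, ← Finset.card_filter, Finset.filter_ne', Finset.card_erase_of_mem (Finset.mem_univ _)]
    simp
  rcases κ with κ | κ | κ | κ <;> simp [thS, el3, sB_ne, sZ_eq, hZ] <;> omega

theorem sZ_injz {n : ℕ} {P P' : Finset (Fin n)} {z z' : Fin n} (h : sZ P z = sZ P' z') : z = z' := by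
  have := congrFun h z
  rw [(sZ_eq P z z).2 rfl] at this
  exact (sZ_eq P' z' z).1 this.symm

theorem sB_inj {n : ℕ} {P P' : Finset (Fin n)} (h : sB P = sB P') : P = P' := by
  ext k
  have := congrFun h k
  unfold sB at this
  split_ifs at this <;> first | tauto | norm_num at this

theorem sZ_injP {n : ℕ} {P P' : Finset (Fin n)} {z z' : Fin n} (h : sZ P z = sZ P' z')
    (hz : z ∈ P ↔ z' ∈ P') : P = P' := by
  have := sZ_injz h
  subst this
  ext k
  by_cases hk : k = z
  · subst hk; exact hz
  · have := congrFun h k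
    unfold sZ sB at this
    rw [if_neg hk, if_neg hk] at this
    split_ifs at this <;> first | tauto | norm_num at this

theorem sZ_ne_sB {n : ℕ} {P P' : Finset (Fin n)} {z : Fin n} (h : sZ P z = sB P') : False := by
  have := congrFun h z
  rw [(sZ_eq P z z).2 rfl] at this
  exact sB_ne P' z this.symm

theorem ThU_ext {i : ℕ} {u u' : ThU i} (h : sZ u.1.1 u.2.1 = sZ u'.1.1 u'.2.1) : u = u' := by
  obtain ⟨⟨P, hP⟩, ⟨z, hz⟩⟩ := u
  obtain ⟨⟨P', hP'⟩, ⟨z', hz'⟩⟩ := u'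
  simp only at *
  obtain rfl := sZ_injP h (by tauto)
  obtain rfl := sZ_injz h
  rfl

theorem ThD_ext {i : ℕ} {u u' : ThD i} (h : sZ u.1.1 u.2.1 = sZ u'.1.1 u'.2.1) : u = u' := by
  obtain ⟨⟨P, hP⟩, ⟨z, hz⟩⟩ := u
  obtain ⟨⟨P', hP'⟩, ⟨z', hz'⟩⟩ := u'
  simp only at *
  obtain rfl := sZ_injP h (by tauto)
  obtain rfl := sZ_injz h
  rfl

theorem el3_inj {n n' : ℕ} {a a' : ℝ} {b b' : Fin n → ℝ} {c c' : Fin n' → ℝ}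
    (h : el3 a b c = el3 a' b' c') : a = a' ∧ b = b' ∧ c = c' :=
  ⟨congrFun h none, funext fun k => congrFun h (some (.inl k)),
    funext fun k => congrFun h (some (.inr k))⟩

theorem thS_inj {i j : ℕ} {κ κ' : ThK i j} (h : thS κ = thS κ') : κ = κ' := by
  rcases κ with ⟨u, v⟩ | ⟨u, v⟩ | ⟨u, v⟩ | ⟨u, v⟩ <;>
  rcases κ' with ⟨u', v'⟩ | ⟨u', v'⟩ | ⟨u', v'⟩ | ⟨u', v'⟩ <;>
  obtain ⟨h1, h2, h3⟩ := el3_inj h <;>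
  first
  | (exfalso; norm_num at h1; done)
  | exact (sZ_ne_sB h2).elim
  | exact (sZ_ne_sB h2.symm).elim
  | (rw [ThU_ext h2, ThU_ext h3])
  | (rw [ThD_ext h2, ThD_ext h3])
  | (rw [ThD_ext h2, Subtype.ext (sB_inj h3)])
  | (rw [ThU_ext h3, Subtype.ext (sB_inj h2)])

/-- `P` is the strict top half of `b`, with minimum `α` on `P` and maximum `β` off `P`. -/
structure ThTop {n : ℕ} (b : Fin n → ℝ) (P : Finset (Fin n)) (α β : ℝ) : Prop where
  lt : β < α
  ge : ∀ k ∈ P, α ≤ b k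
  le : ∀ k, k ∉ P → b k ≤ β
  eA : ∃ k ∈ P, b k = α
  eB : ∃ k, k ∉ P ∧ b k = β

theorem ThTop.unique {n : ℕ} {b b' : Fin n → ℝ} {P P' : Finset (Fin n)} {α β α' β' t : ℝ}
    (h : ThTop b P α β) (h' : ThTop b' P' α' β') (hc : P.card = P'.card)
    (ht : ∀ k, b' k = b k + t) : α' = α + t ∧ β' = β + t := by
  have hP : P = P' := by
    by_contra hne
    have h1 : ¬ P ⊆ P' := fun hs => hne (Finset.eq_of_subset_of_card_le hs hc.ge)
    have h2 : ¬ P' ⊆ P := fun hs => hne (Finset.eq_of_subset_of_card_le hs hc.le).symm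
    obtain ⟨p, hp, hp'⟩ := Finset.not_subset.1 h1
    obtain ⟨q, hq, hq'⟩ := Finset.not_subset.1 h2
    have := h.ge p hp
    have := h.le q hq'
    have := h'.ge q hq
    have := h'.le p hp'
    have := ht p
    have := ht q
    have := h.lt
    have := h'.lt
    linarith
  subst hP
  obtain ⟨x, hx, hxe⟩ := h.eA
  obtain ⟨x', hx', hxe'⟩ := h'.eA
  obtain ⟨y, hy, hye⟩ := h.eB
  obtain ⟨y', hy', hye'⟩ := h'.eB
  have := h.ge x' hx'
  have := h'.ge x hx
  have := h.le y' hy'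
  have := h'.le y hy
  have := ht x
  have := ht x'
  have := ht y
  have := ht y'
  constructor <;> linarith

theorem th_half_ne {i : ℕ} (hi : 1 ≤ i) (P : ThB i) : P.1.Nonempty ∧ (P.1ᶜ).Nonempty := by
  constructor
  · rw [← Finset.card_pos, P.2]; omega
  · rw [← Finset.card_pos, Finset.card_compl, P.2, Fintype.card_fin]; omega

theorem sZ_mul {n : ℕ} {P : Finset (Fin n)} {z : Fin n} {b : Fin n → ℝ} {g : Fin n → ℕ}
    (hg : ∀ k, sZ P z k = 0 ↔ g k = 0) (hb : ∀ k, b k = sZ P z k * g k) :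
    b z = 0 ∧ (∀ k ∈ P, k ≠ z → 0 < b k) ∧ (∀ k, k ∉ P → k ≠ z → b k < 0) := by
  have pos : ∀ k, k ≠ z → (0:ℝ) < g k := fun k hk => by
    have : g k ≠ 0 := fun h => hk ((sZ_eq P z k).1 ((hg k).2 h))
    exact_mod_cast Nat.pos_of_ne_zero this
  refine ⟨by rw [hb, (sZ_eq P z z).2 rfl, zero_mul], ?_, ?_⟩
  · intro k hk hz
    rw [hb, sZ, if_neg hz, sB, if_pos hk]; linarith [pos k hz]
  · intro k hk hz
    rw [hb, sZ, if_neg hz, sB, if_neg hk]; linarith [pos k hz]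

theorem sB_mul {n : ℕ} {P : Finset (Fin n)} {b : Fin n → ℝ} {g : Fin n → ℕ}
    (hg : ∀ k, sB P k = 0 ↔ g k = 0) (hb : ∀ k, b k = sB P k * g k) :
    (∀ k ∈ P, 0 < b k) ∧ (∀ k, k ∉ P → b k < 0) := by
  have pos : ∀ k, (0:ℝ) < g k := fun k => by
    have : g k ≠ 0 := fun h => sB_ne P k ((hg k).2 h)
    exact_mod_cast Nat.pos_of_ne_zero this
  refine ⟨?_, ?_⟩
  · intro k hk
    rw [hb, sB, if_pos hk]; linarith [pos k]
  · intro k hk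
    rw [hb, sB, if_neg hk]; linarith [pos k]

theorem ThU_top {i : ℕ} (hi : 1 ≤ i) (u : ThU i) {b : Fin (2 * i) → ℝ} {g : Fin (2 * i) → ℕ}
    (hg : ∀ k, sZ u.1.1 u.2.1 k = 0 ↔ g k = 0) (hb : ∀ k, b k = sZ u.1.1 u.2.1 k * g k) :
    ∃ P : Finset (Fin (2 * i)), P.card = i ∧ ∃ α, 0 < α ∧ ThTop b P α 0 := by
  obtain ⟨h0, h1, h2⟩ := sZ_mul hg hb
  obtain ⟨x, hx, hm⟩ := Finset.exists_min_image _ b (th_half_ne hi u.1).1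
  have hx0 : 0 < b x := h1 x hx (fun h => u.2.2 (h ▸ hx))
  refine ⟨u.1.1, u.1.2, b x, hx0, ⟨hx0, hm, ?_, ⟨x, hx, rfl⟩, ⟨u.2.1, u.2.2, h0⟩⟩⟩
  intro k hk
  by_cases hz : k = u.2.1
  · rw [hz, h0]
  · exact (h2 k hk hz).le

theorem ThD_top {i : ℕ} (hi : 1 ≤ i) (u : ThD i) {b : Fin (2 * i) → ℝ} {g : Fin (2 * i) → ℕ}
    (hg : ∀ k, sZ u.1.1 u.2.1 k = 0 ↔ g k = 0) (hb : ∀ k, b k = sZ u.1.1 u.2.1 k * g k) :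
    ∃ P : Finset (Fin (2 * i)), P.card = i ∧ ∃ β, β < 0 ∧ ThTop b P 0 β := by
  obtain ⟨h0, h1, h2⟩ := sZ_mul hg hb
  obtain ⟨x, hx, hm⟩ := Finset.exists_max_image _ b (th_half_ne hi u.1).2
  rw [Finset.mem_compl] at hx
  have hx0 : b x < 0 := h2 x hx (fun h => hx (h ▸ u.2.2))
  refine ⟨u.1.1, u.1.2, b x, hx0, ⟨hx0, ?_, fun k hk => hm k (Finset.mem_compl.2 hk),
    ⟨u.2.1, u.2.2, h0⟩, ⟨x, hx, rfl⟩⟩⟩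
  intro k hk
  by_cases hz : k = u.2.1
  · rw [hz, h0]
  · exact (h1 k hk hz).le

theorem ThB_top {i : ℕ} (hi : 1 ≤ i) (u : ThB i) {b : Fin (2 * i) → ℝ} {g : Fin (2 * i) → ℕ}
    (hg : ∀ k, sB u.1 k = 0 ↔ g k = 0) (hb : ∀ k, b k = sB u.1 k * g k) :
    ∃ P : Finset (Fin (2 * i)), P.card = i ∧ ∃ α β, 0 < α ∧ β < 0 ∧ ThTop b P α β := by
  obtain ⟨h1, h2⟩ := sB_mul hg hb
  obtain ⟨x, hx, hm⟩ := Finset.exists_max_image _ b (th_half_ne hi u).2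
  obtain ⟨y, hy, hm'⟩ := Finset.exists_min_image _ b (th_half_ne hi u).1
  rw [Finset.mem_compl] at hx
  exact ⟨u.1, u.2, b y, b x, h1 y hy, h2 x hx, ⟨(h2 x hx).trans (h1 y hy), hm',
    fun k hk => hm k (Finset.mem_compl.2 hk), ⟨y, hy, rfl⟩, ⟨x, hx, rfl⟩⟩⟩

theorem th_top {i j : ℕ} (hi : 1 ≤ i) (hj : 1 ≤ j) (κ : ThK i j) {f : ThE i j → ℝ}
    {g : ThE i j → ℕ} (hg : ∀ e, thS κ e = 0 ↔ g e = 0) (hf : ∀ e, f e = thS κ e * g e) :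
    ∃ P Q α β γ δ, P.card = i ∧ Q.card = j ∧ ThTop (fun k => f (some (.inl k))) P α β ∧
      ThTop (fun k => f (some (.inr k))) Q γ δ ∧
      ((0 < f none ∧ β = 0 ∧ 0 < α ∧ δ = 0 ∧ 0 < γ) ∨
       (f none < 0 ∧ α = 0 ∧ β < 0 ∧ γ = 0 ∧ δ < 0) ∨
       (f none = 0 ∧ α = 0 ∧ β < 0 ∧ 0 < γ ∧ δ < 0) ∨
       (f none = 0 ∧ β < 0 ∧ 0 < α ∧ δ = 0 ∧ 0 < γ)) := by
  have h0 := hg none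
  have h0' := hf none
  rcases κ with ⟨u, v⟩ | ⟨u, v⟩ | ⟨u, v⟩ | ⟨u, v⟩
  · obtain ⟨P, hP, α, hα, hT⟩ := ThU_top hi u (fun k => hg (some (.inl k))) (fun k => hf (some (.inl k)))
    obtain ⟨Q, hQ, γ, hγ, hT'⟩ := ThU_top hj v (fun k => hg (some (.inr k))) (fun k => hf (some (.inr k)))
    refine ⟨P, Q, α, 0, γ, 0, hP, hQ, hT, hT', Or.inl ⟨?_, rfl, hα, rfl, hγ⟩⟩
    simp [thS, el3] at h0 h0'
    rw [h0']; exact_mod_cast Nat.pos_of_ne_zero h0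
  · obtain ⟨P, hP, α, hα, hT⟩ := ThD_top hi u (fun k => hg (some (.inl k))) (fun k => hf (some (.inl k)))
    obtain ⟨Q, hQ, γ, hγ, hT'⟩ := ThD_top hj v (fun k => hg (some (.inr k))) (fun k => hf (some (.inr k)))
    refine ⟨P, Q, 0, α, 0, γ, hP, hQ, hT, hT', Or.inr (Or.inl ⟨?_, rfl, hα, rfl, hγ⟩)⟩
    simp [thS, el3] at h0 h0'
    rw [h0', neg_lt_zero]; exact_mod_cast Nat.pos_of_ne_zero h0
  · obtain ⟨P, hP, α, hα, hT⟩ := ThD_top hi u (fun k => hg (some (.inl k))) (fun k => hf (some (.inl k)))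
    obtain ⟨Q, hQ, γ, δ, hγ, hδ, hT'⟩ := ThB_top hj v (fun k => hg (some (.inr k))) (fun k => hf (some (.inr k)))
    refine ⟨P, Q, 0, α, γ, δ, hP, hQ, hT, hT', Or.inr (Or.inr (Or.inl ⟨?_, rfl, hα, hγ, hδ⟩))⟩
    simpa [thS, el3] using h0'
  · obtain ⟨P, hP, α, β, hα, hβ, hT⟩ := ThB_top hi u (fun k => hg (some (.inl k))) (fun k => hf (some (.inl k)))
    obtain ⟨Q, hQ, γ, hγ, hT'⟩ := ThU_top hj v (fun k => hg (some (.inr k))) (fun k => hf (some (.inr k)))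
    refine ⟨P, Q, α, β, γ, 0, hP, hQ, hT, hT', Or.inr (Or.inr (Or.inr ⟨?_, hβ, hα, rfl, hγ⟩))⟩
    simpa [thS, el3] using h0'

theorem th_elem {s s' : ℝ} {g g' : ℕ} (hs : s = -1 ∨ s = 0 ∨ s = 1) (hs' : s' = -1 ∨ s' = 0 ∨ s' = 1)
    (hg : s = 0 ↔ g = 0) (hg' : s' = 0 ↔ g' = 0) (h : s * g = s' * g') : s = s' ∧ g = g' := by
  have h1 : (0:ℝ) ≤ g := by positivity
  have h2 : (0:ℝ) ≤ g' := by positivity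
  have hc : ((g:ℝ) = 0 ↔ g = 0) := Nat.cast_eq_zero
  have hc' : ((g':ℝ) = 0 ↔ g' = 0) := Nat.cast_eq_zero
  rw [← hc] at hg
  rw [← hc'] at hg'
  have : s = s' ∧ (g:ℝ) = g' := by
    rcases hs with rfl | rfl | rfl <;> rcases hs' with rfl | rfl | rfl <;> norm_num at * <;>
      first | linarith | (exfalso; first | (apply hg; linarith) | (apply hg'; linarith) | (apply hg'; exact_mod_cast h.symm))
  exact_mod_cast this

/-- Uniqueness of the open-cell representation up to circulations. -/
theorem th_inj {i j : ℕ} (hi : 1 ≤ i) (hj : 1 ≤ j) (κ κ' : ThK i j) (g g' : ThE i j → ℕ)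
    (hg : ∀ e, thS κ e = 0 ↔ g e = 0) (hg' : ∀ e, thS κ' e = 0 ↔ g' e = 0) (s t r : ℝ)
    (hstr : s + t + r = 0)
    (ha : thS κ' none * g' none = thS κ none * g none + s)
    (hb : ∀ k, thS κ' (some (.inl k)) * g' (some (.inl k)) =
      thS κ (some (.inl k)) * g (some (.inl k)) + t)
    (hc : ∀ k, thS κ' (some (.inr k)) * g' (some (.inr k)) =
      thS κ (some (.inr k)) * g (some (.inr k)) + r) : κ = κ' ∧ g = g' := by
  obtain ⟨P, Q, α, β, γ, δ, hP, hQ, hT, hS, h⟩ := th_top hi hj κ hg (fun _ => rfl)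
  obtain ⟨P', Q', α', β', γ', δ', hP', hQ', hT', hS', h'⟩ := th_top hi hj κ' hg' (fun _ => rfl)
  obtain ⟨rfl, rfl⟩ := hT.unique hT' (hP.trans hP'.symm) hb
  obtain ⟨rfl, rfl⟩ := hS.unique hS' (hQ.trans hQ'.symm) hc
  rw [ha] at h'
  have h0 : s = 0 ∧ t = 0 ∧ r = 0 := by
    clear hT hS hT' hS' ha hb hc hg hg'
    generalize thS κ none * (g none : ℝ) = a at *
    rcases h with ⟨h1, h2, h3, h4, h5⟩ | ⟨h1, h2, h3, h4, h5⟩ | ⟨h1, h2, h3, h4, h5⟩ | ⟨h1, h2, h3, h4, h5⟩ <;>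
    rcases h' with ⟨k1, k2, k3, k4, k5⟩ | ⟨k1, k2, k3, k4, k5⟩ | ⟨k1, k2, k3, k4, k5⟩ | ⟨k1, k2, k3, k4, k5⟩ <;>
    first
    | (exfalso; linarith)
    | (refine ⟨?_, ?_, ?_⟩ <;> linarith)
  obtain ⟨rfl, rfl, rfl⟩ := h0
  have key : ∀ e, thS κ e * g e = thS κ' e * g' e := by
    rintro (_ | k | k)
    · rw [ha, add_zero]
    · rw [hb, add_zero]
    · rw [hc, add_zero]
  have key2 := fun e => th_elem (thS_vals κ e) (thS_vals κ' e) (hg e) (hg' e) (key e)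
  exact ⟨thS_inj (funext fun e => (key2 e).1), funext fun e => (key2 e).2⟩

theorem th_half {i : ℕ} (hi : 1 ≤ i) (b : Fin (2 * i) → ℝ) :
    ∃ P : ThB i, ∃ x y, x ∈ P.1 ∧ y ∉ P.1 ∧ (∀ k ∈ P.1, b x ≤ b k) ∧ (∀ k, k ∉ P.1 → b k ≤ b y) ∧
      b y ≤ b x := by
  classical
  have hne : (Finset.powersetCard i (Finset.univ : Finset (Fin (2 * i)))).Nonempty := by
    rw [Finset.powersetCard_nonempty]; simp; omega
  obtain ⟨P, hP, hmax⟩ := Finset.exists_max_image _ (fun P => ∑ k ∈ P, b k) hne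
  have hPc : P.card = i := (Finset.mem_powersetCard.1 hP).2
  obtain ⟨y, hy, hm⟩ := Finset.exists_max_image _ b (th_half_ne hi ⟨P, hPc⟩).2
  obtain ⟨x, hx, hm'⟩ := Finset.exists_min_image _ b (th_half_ne hi ⟨P, hPc⟩).1
  rw [Finset.mem_compl] at hy
  refine ⟨⟨P, hPc⟩, x, y, hx, hy, hm', fun k hk => hm k (Finset.mem_compl.2 hk), ?_⟩
  simp only at hx hy
  have hy' : y ∉ P.erase x := fun h => hy (Finset.mem_of_mem_erase h)
  have h1 := hmax (insert y (P.erase x)) (by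
    rw [Finset.mem_powersetCard]
    refine ⟨Finset.subset_univ _, ?_⟩
    rw [Finset.card_insert_of_notMem hy', Finset.card_erase_of_mem hx]; omega)
  rw [Finset.sum_insert hy', ← Finset.add_sum_erase P b hx] at h1
  linarith

theorem sB_sum {i : ℕ} (P : ThB i) : ∑ k, sB P.1 k = 0 := by
  classical
  unfold sB
  rw [Finset.sum_ite]
  have : (Finset.univ.filter (fun k => k ∉ P.1)) = P.1ᶜ := by ext; simp
  simp [this, P.2, Finset.card_compl, show 2 * i - i = i by omega]

theorem sZ_sum {i : ℕ} (P : ThB i) (z) : ∑ k, sZ P.1 z k = - sB P.1 z := by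
  classical
  have h : ∀ k, sZ P.1 z k = sB P.1 k - if k = z then sB P.1 z else 0 := by
    intro k; unfold sZ; split_ifs with h <;> simp [h]
  simp [h, sB_sum]

theorem sB_closed {n : ℕ} {P : Finset (Fin n)} {b : Fin n → ℝ} (h1 : ∀ k ∈ P, 0 ≤ b k)
    (h2 : ∀ k, k ∉ P → b k ≤ 0) (k) : b k = sB P k * |b k| := by
  unfold sB
  split_ifs with h
  · rw [abs_of_nonneg (h1 k h), one_mul]
  · rw [abs_of_nonpos (h2 k h)]; ring

theorem sZ_closed {n : ℕ} {P : Finset (Fin n)} {z : Fin n} {b : Fin n → ℝ} (h1 : ∀ k ∈ P, 0 ≤ b k)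
    (h2 : ∀ k, k ∉ P → b k ≤ 0) (hz : b z = 0) (k) : b k = sZ P z k * |b k| := by
  unfold sZ
  split_ifs with h
  · rw [h, hz]; simp
  · exact sB_closed h1 h2 k

theorem th_elem_norm {τ x t : ℝ} (hτ : τ = -1 ∨ τ = 0 ∨ τ = 1) (h : x + t = τ * |x + t|) :
    |x + t| - t * τ ≤ |x| := by
  rcases hτ with rfl | rfl | rfl
  · have := neg_abs_le x
    linarith
  · have := abs_nonneg x
    have h2 : x + t = 0 := by linarith
    rw [h2]; simp
  · have := le_abs_self x
    linarith

theorem th_norm {n : ℕ} {τ b : Fin n → ℝ} {t : ℝ} (hτ : ∀ k, τ k = -1 ∨ τ k = 0 ∨ τ k = 1)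
    (h : ∀ k, b k + t = τ k * |b k + t|) :
    ∑ k, |b k + t| - t * ∑ k, τ k ≤ ∑ k, |b k| := by
  rw [Finset.mul_sum, ← Finset.sum_sub_distrib]
  exact Finset.sum_le_sum fun k _ => th_elem_norm (hτ k) (h k)

theorem th_red {i j : ℕ} (hi : 1 ≤ i) (hj : 1 ≤ j) (a : ℝ) (b : Fin (2 * i) → ℝ)
    (c : Fin (2 * j) → ℝ) : ∃ κ : ThK i j, ∃ s t r : ℝ, s + t + r = 0 ∧
      (∀ e, el3 (a + s) (fun k => b k + t) (fun k => c k + r) e =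
        thS κ e * |el3 (a + s) (fun k => b k + t) (fun k => c k + r) e|) ∧
      |a + s| + (∑ k, |b k + t| + ∑ k, |c k + r|) ≤ |a| + (∑ k, |b k| + ∑ k, |c k|) ∧
      (((∃ k, b k + t = 0) ∧ (∃ k, c k + r = 0)) ∨
        (a + s = 0 ∧ ((∃ k, b k + t = 0) ∨ (∃ k, c k + r = 0)))) := by
  obtain ⟨P, x, y, hx, hy, hPx, hPy, hxy⟩ := th_half hi b
  obtain ⟨Q, z, w, hz, hw, hQz, hQw, hzw⟩ := th_half hj c
  have sy : sB P.1 y = -1 := if_neg hy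
  have sx : sB P.1 x = 1 := if_pos hx
  have sw : sB Q.1 w = -1 := if_neg hw
  have sz : sB Q.1 z = 1 := if_pos hz
  -- signs after a shift
  have bP : ∀ t, 0 ≤ b x + t → ∀ k ∈ P.1, 0 ≤ b k + t := fun t h k hk => by linarith [hPx k hk]
  have bN : ∀ t, b y + t ≤ 0 → ∀ k, k ∉ P.1 → b k + t ≤ 0 := fun t h k hk => by linarith [hPy k hk]
  have cP : ∀ t, 0 ≤ c z + t → ∀ k ∈ Q.1, 0 ≤ c k + t := fun t h k hk => by linarith [hQz k hk]
  have cN : ∀ t, c w + t ≤ 0 → ∀ k, k ∉ Q.1 → c k + t ≤ 0 := fun t h k hk => by linarith [hQw k hk]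
  by_cases c1 : 0 ≤ a + b y + c w
  · have B1 := sZ_closed (bP (-b y) (by linarith)) (bN (-b y) (by linarith)) (by ring : b y + -b y = 0)
    have C1 := sZ_closed (cP (-c w) (by linarith)) (cN (-c w) (by linarith)) (by ring : c w + -c w = 0)
    have A1 : a + (b y + c w) = 1 * |a + (b y + c w)| := by
      rw [abs_of_nonneg (by linarith)]; ring
    refine ⟨.inl (⟨P, y, hy⟩, ⟨Q, w, hw⟩), b y + c w, -b y, -c w, by ring, ?_, ?_,
      Or.inl ⟨⟨y, by ring⟩, ⟨w, by ring⟩⟩⟩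
    · rintro (_ | k | k)
      · exact A1
      · exact B1 k
      · exact C1 k
    · have n1 := th_norm (fun k => sZ_vals P.1 y k) B1
      have n2 := th_norm (fun k => sZ_vals Q.1 w k) C1
      have n3 := th_elem_norm (by simp) A1
      rw [sZ_sum, sy] at n1
      rw [sZ_sum, sw] at n2
      linarith
  by_cases c2 : a + b x + c z ≤ 0
  · have B1 := sZ_closed (bP (-b x) (by linarith)) (bN (-b x) (by linarith)) (by ring : b x + -b x = 0)
    have C1 := sZ_closed (cP (-c z) (by linarith)) (cN (-c z) (by linarith)) (by ring : c z + -c z = 0)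
    have A1 : a + (b x + c z) = (-1) * |a + (b x + c z)| := by
      rw [abs_of_nonpos (by linarith)]; ring
    refine ⟨.inr (.inl (⟨P, x, hx⟩, ⟨Q, z, hz⟩)), b x + c z, -b x, -c z, by ring, ?_, ?_,
      Or.inl ⟨⟨x, by ring⟩, ⟨z, by ring⟩⟩⟩
    · rintro (_ | k | k)
      · exact A1
      · exact B1 k
      · exact C1 k
    · have n1 := th_norm (fun k => sZ_vals P.1 x k) B1
      have n2 := th_norm (fun k => sZ_vals Q.1 z k) C1
      have n3 := th_elem_norm (by simp) A1
      rw [sZ_sum, sx] at n1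
      rw [sZ_sum, sz] at n2
      linarith
  have A1 : a + -a = 0 * |a + -a| := by ring
  have n3 := th_elem_norm (by simp) A1
  by_cases c3 : a + c w ≤ - b x
  · have B1 := sZ_closed (bP (-b x) (by linarith)) (bN (-b x) (by linarith)) (by ring : b x + -b x = 0)
    have B2 := sB_closed (bP (-b x) (by linarith)) (bN (-b x) (by linarith))
    have C1 := sB_closed (cP (a + b x) (by linarith)) (cN (a + b x) (by linarith))
    refine ⟨.inr (.inr (.inl (⟨P, x, hx⟩, Q))), -a, -b x, a + b x, by ring, ?_, ?_,
      Or.inr ⟨by ring, Or.inl ⟨x, by ring⟩⟩⟩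
    · rintro (_ | k | k)
      · exact A1
      · exact B1 k
      · exact C1 k
    · have n1 := th_norm (fun k => sB_vals P.1 k) B2
      have n2 := th_norm (fun k => sB_vals Q.1 k) C1
      rw [sB_sum] at n1
      rw [sB_sum] at n2
      linarith
  · have B1 := sB_closed (bP (a + c w) (by linarith)) (bN (a + c w) (by linarith))
    have C1 := sZ_closed (cP (-c w) (by linarith)) (cN (-c w) (by linarith)) (by ring : c w + -c w = 0)
    have C2 := sB_closed (cP (-c w) (by linarith)) (cN (-c w) (by linarith))
    refine ⟨.inr (.inr (.inr (P, ⟨Q, w, hw⟩))), -a, a + c w, -c w, by ring, ?_, ?_,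
      Or.inr ⟨by ring, Or.inr ⟨w, by ring⟩⟩⟩
    · rintro (_ | k | k)
      · exact A1
      · exact B1 k
      · exact C1 k
    · have n1 := th_norm (fun k => sB_vals P.1 k) B1
      have n2 := th_norm (fun k => sB_vals Q.1 k) C2
      rw [sB_sum] at n1
      rw [sB_sum] at n2
      linarith

def thSrc {V : Type*} (p q : ℕ → V) (n n' : ℕ) : Option (Fin n ⊕ Fin n') → V
  | none => p 0
  | some (.inl k) => p k
  | some (.inr k) => q k

def thTgt {V : Type*} (p q : ℕ → V) (n n' : ℕ) : Option (Fin n ⊕ Fin n') → V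
  | none => p n
  | some (.inl k) => p (k + 1)
  | some (.inr k) => q (k + 1)

noncomputable def thW {V : Type*} [DecidableEq V] (p q : ℕ → V) (n n' : ℕ)
    (e : Option (Fin n ⊕ Fin n')) : V → ℝ :=
  Pi.single (thSrc p q n n' e) 1 - Pi.single (thTgt p q n n' e) 1

noncomputable def thDiv {V : Type*} [DecidableEq V] (p q : ℕ → V) (n n' : ℕ)
    (f : Option (Fin n ⊕ Fin n') → ℝ) : V → ℝ := ∑ e, f e • thW p q n n' e

structure ThG {V : Type*} (p q : ℕ → V) (n n' : ℕ) : Prop where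
  hn : 2 ≤ n
  hn' : 2 ≤ n'
  hp : ∀ k l, k ≤ n → l ≤ n → p k = p l → k = l
  hq : ∀ k l, k ≤ n' → l ≤ n' → q k = q l → k = l
  h0 : p 0 = q 0
  h1 : p n = q n'
  hd : ∀ k l, k ≤ n → l ≤ n' → p k = q l → (k = 0 ∧ l = 0) ∨ (k = n ∧ l = n')

section
variable {V : Type*} [DecidableEq V] {p q : ℕ → V} {n n' : ℕ}

theorem thDiv_add (f f' : Option (Fin n ⊕ Fin n') → ℝ) :
    thDiv p q n n' (fun e => f e + f' e) = thDiv p q n n' f + thDiv p q n n' f' := by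
  simp [thDiv, add_smul, Finset.sum_add_distrib]

theorem thDiv_smul (a : ℝ) (f : Option (Fin n ⊕ Fin n') → ℝ) :
    thDiv p q n n' (fun e => a * f e) = a • thDiv p q n n' f := by
  simp [thDiv, mul_smul, Finset.smul_sum]

theorem thDiv_shift (h : ThG p q n n') {s t r : ℝ} (hs : s + t + r = 0) :
    thDiv p q n n' (el3 s (fun _ => t) (fun _ => r)) = 0 := by
  have tel : ∀ (p : ℕ → V) (n : ℕ), ∑ k : Fin n, ((Pi.single (p k) 1 : V → ℝ) -
      Pi.single (p (k + 1)) 1) = Pi.single (p 0) 1 - Pi.single (p n) 1 := by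
    intro p n
    exact (Fin.sum_univ_eq_sum_range (fun k => ((Pi.single (p k) 1 : V → ℝ) -
      Pi.single (p (k + 1)) 1)) n).trans
      (Finset.sum_range_sub' (fun k => (Pi.single (p k) 1 : V → ℝ)) n)
  simp only [thDiv, Fintype.sum_option, Fintype.sum_sum_type, el3, Option.elim, Sum.elim_inl,
    Sum.elim_inr, thW, thSrc, thTgt, ← Finset.smul_sum, tel]
  rw [← h.h0, ← h.h1, ← add_smul, ← add_smul, ← add_assoc, hs, zero_smul]

theorem thDiv_eval (f : Option (Fin n ⊕ Fin n') → ℝ) (v : V) : thDiv p q n n' f v =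
    f none * ((if v = p 0 then 1 else 0) - (if v = p n then 1 else 0)) +
    (∑ k, f (some (.inl k)) * ((if v = p k then 1 else 0) - (if v = p (k + 1) then 1 else 0)) +
    ∑ k, f (some (.inr k)) * ((if v = q k then 1 else 0) - (if v = q (k + 1) then 1 else 0))) := by
  simp [thDiv, Fintype.sum_option, Fintype.sum_sum_type, thW, thSrc, thTgt, Pi.single_apply]

theorem thDiv_p (h : ThG p q n n') (f : Option (Fin n ⊕ Fin n') → ℝ) (k : ℕ) (hk : k + 1 < n) :
    thDiv p q n n' f (p (k + 1)) =
      f (some (.inl ⟨k + 1, hk⟩)) - f (some (.inl ⟨k, by omega⟩)) := by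
  rw [thDiv_eval]
  have e1 : ¬ p (k + 1) = p 0 := fun e => by have := h.hp _ _ (by omega) (by omega) e; omega
  have e2 : ¬ p (k + 1) = p n := fun e => by have := h.hp _ _ (by omega) (by omega) e; omega
  have e3 : ∀ l : Fin n, p (k + 1) = p l ↔ l = ⟨k + 1, hk⟩ := fun l =>
    ⟨fun e => by have := h.hp _ _ (by omega) (by omega) e; ext; simp; omega, fun e => by rw [e]⟩
  have e4 : ∀ l : Fin n, p (k + 1) = p (l + 1) ↔ l = ⟨k, by omega⟩ := fun l =>
    ⟨fun e => by have := h.hp _ _ (by omega) (by omega) e; ext; simp; omega, fun e => by rw [e]⟩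
  have e5 : ∀ l : Fin n', ¬ p (k + 1) = q l := fun l e => by
    have := h.hd _ _ (by omega) (by omega) e; omega
  have e6 : ∀ l : Fin n', ¬ p (k + 1) = q (l + 1) := fun l e => by
    have := h.hd _ _ (by omega) (by omega) e; omega
  simp [e1, e2, e3, e4, e5, e6, mul_sub, Finset.sum_sub_distrib]

theorem thDiv_q (h : ThG p q n n') (f : Option (Fin n ⊕ Fin n') → ℝ) (k : ℕ) (hk : k + 1 < n') :
    thDiv p q n n' f (q (k + 1)) =
      f (some (.inr ⟨k + 1, hk⟩)) - f (some (.inr ⟨k, by omega⟩)) := by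
  rw [thDiv_eval]
  have e1 : ¬ q (k + 1) = p 0 := fun e => by have := h.hd _ _ (by omega) (by omega) e.symm; omega
  have e2 : ¬ q (k + 1) = p n := fun e => by have := h.hd _ _ (by omega) (by omega) e.symm; omega
  have e3 : ∀ l : Fin n', q (k + 1) = q l ↔ l = ⟨k + 1, hk⟩ := fun l =>
    ⟨fun e => by have := h.hq _ _ (by omega) (by omega) e; ext; simp; omega, fun e => by rw [e]⟩
  have e4 : ∀ l : Fin n', q (k + 1) = q (l + 1) ↔ l = ⟨k, by omega⟩ := fun l =>
    ⟨fun e => by have := h.hq _ _ (by omega) (by omega) e; ext; simp; omega, fun e => by rw [e]⟩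
  have e5 : ∀ l : Fin n, ¬ q (k + 1) = p l := fun l e => by
    have := h.hd _ _ (by omega) (by omega) e.symm; omega
  have e6 : ∀ l : Fin n, ¬ q (k + 1) = p (l + 1) := fun l e => by
    have := h.hd _ _ (by omega) (by omega) e.symm; omega
  simp [e1, e2, e3, e4, e5, e6, mul_sub, Finset.sum_sub_distrib]

theorem thDiv_0 (h : ThG p q n n') (f : Option (Fin n ⊕ Fin n') → ℝ) :
    thDiv p q n n' f (p 0) = f none + (f (some (.inl ⟨0, by have := h.hn; omega⟩)) +
      f (some (.inr ⟨0, by have := h.hn'; omega⟩))) := by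
  rw [thDiv_eval]
  have := h.hn
  have := h.hn'
  have e2 : ¬ p 0 = p n := fun e => by have := h.hp _ _ (by omega) (by omega) e; omega
  have e3 : ∀ l : Fin n, p 0 = p l ↔ l = ⟨0, by omega⟩ := fun l =>
    ⟨fun e => by have := h.hp _ _ (by omega) (by omega) e; ext; simp; omega, fun e => by rw [e]⟩
  have e4 : ∀ l : Fin n, ¬ p 0 = p (l + 1) := fun l e => by
    have := h.hp _ _ (by omega) (by omega) e; omega
  have e5 : ∀ l : Fin n', p 0 = q l ↔ l = ⟨0, by omega⟩ := fun l =>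
    ⟨fun e => by have := h.hd _ _ (by omega) (by omega) e; ext; simp; omega,
      fun e => by rw [e]; exact h.h0⟩
  have e6 : ∀ l : Fin n', ¬ p 0 = q (l + 1) := fun l e => by
    have := h.hd _ _ (by omega) (by omega) e; omega
  simp [e2, e3, e4, e5, e6]

/-- consecutive differences in a subgroup implies all differences are -/
theorem th_chain {m : ℕ} (b : Fin m → ℝ) (S : AddSubgroup ℝ)
    (h : ∀ k (hk : k + 1 < m), b ⟨k + 1, hk⟩ - b ⟨k, by omega⟩ ∈ S) (k l : Fin m) :
    b k - b l ∈ S := by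
  have key : ∀ k (hk : k < m), b ⟨k, hk⟩ - b ⟨0, by omega⟩ ∈ S := by
    intro k
    induction k with
    | zero => intro hk; simp
    | succ k ih =>
      intro hk
      have := S.add_mem (h k hk) (ih (by omega))
      simpa using this
  have := S.sub_mem (key k.1 k.2) (key l.1 l.2)
  simpa using this

theorem th_int (h : ThG p q n n') (S : AddSubgroup ℝ) (f : Option (Fin n ⊕ Fin n') → ℝ)
    (hS : ∀ v, thDiv p q n n' f v ∈ S) :
    (∀ k l, f (some (.inl k)) - f (some (.inl l)) ∈ S) ∧
    (∀ k l, f (some (.inr k)) - f (some (.inr l)) ∈ S) ∧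
    (∀ k l, f none + (f (some (.inl k)) + f (some (.inr l))) ∈ S) := by
  have hb := th_chain (fun k => f (some (.inl k))) S
    (fun k hk => by have := hS (p (k + 1)); rwa [thDiv_p h f k hk] at this)
  have hc := th_chain (fun k => f (some (.inr k))) S
    (fun k hk => by have := hS (q (k + 1)); rwa [thDiv_q h f k hk] at this)
  refine ⟨hb, hc, fun k l => ?_⟩
  have h0 := hS (p 0)
  rw [thDiv_0 h] at h0
  have h3 := S.add_mem h0 (S.add_mem (hb k ⟨0, by have := h.hn; omega⟩) (hc l ⟨0, by have := h.hn'; omega⟩))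
  simp only at h3
  convert h3 using 1
  ring

theorem th_adj_mem {G : SimpleGraph V} {x : V → ℝ} {m : ℕ}
    (hadj : ∀ u v, G.Adj u v → ∃ e, (thSrc p q n n' e = u ∧ thTgt p q n n' e = v) ∨
      (thSrc p q n n' e = v ∧ thTgt p q n n' e = u))
    (hx : x ∈ (m : ℝ) • symEdgePolytope G) :
    ∃ f, ∑ e, |f e| ≤ (m : ℝ) ∧ thDiv p q n n' f = x := by
  obtain ⟨y, hy, rfl⟩ := hx
  have key : symEdgePolytope G ⊆ {y | ∃ f, ∑ e, |f e| ≤ (1 : ℝ) ∧ thDiv p q n n' f = y} := by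
    apply convexHull_min
    · rintro y ⟨v, w, hvw, rfl⟩
      obtain ⟨e, ⟨rfl, rfl⟩ | ⟨rfl, rfl⟩⟩ := hadj v w hvw
      · refine ⟨fun e' => if e' = e then 1 else 0, ?_, ?_⟩
        · simp [apply_ite abs]
        · simp [thDiv, thW]
      · refine ⟨fun e' => if e' = e then -1 else 0, ?_, ?_⟩
        · simp [apply_ite abs]
        · simp [thDiv, thW]
    · rintro y ⟨f, hf, rfl⟩ y' ⟨f', hf', rfl⟩ a b ha hb hab
      refine ⟨fun e => a * f e + b * f' e, ?_, ?_⟩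
      · calc ∑ e, |a * f e + b * f' e| ≤ ∑ e, (a * |f e| + b * |f' e|) := by
              refine Finset.sum_le_sum fun e _ => (abs_add_le _ _).trans ?_
              rw [abs_mul, abs_mul, abs_of_nonneg ha, abs_of_nonneg hb]
          _ = a * ∑ e, |f e| + b * ∑ e, |f' e| := by
              rw [Finset.sum_add_distrib, Finset.mul_sum, Finset.mul_sum]
          _ ≤ a * 1 + b * 1 := by gcongr
          _ = 1 := by linarith
      · rw [thDiv_add, thDiv_smul, thDiv_smul]
  obtain ⟨f, hf, rfl⟩ := key hy
  refine ⟨fun e => m * f e, ?_, ?_⟩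
  · simp only [abs_mul, ← Finset.mul_sum, Nat.abs_cast]
    exact mul_le_of_le_one_right (by positivity) hf
  · simp [thDiv_smul]

theorem th_mem_adj {G : SimpleGraph V} {f : Option (Fin n ⊕ Fin n') → ℝ} {m : ℕ} (hm : 0 < m)
    (hadj : ∀ e, G.Adj (thSrc p q n n' e) (thTgt p q n n' e)) (hf : ∑ e, |f e| ≤ (m : ℝ)) :
    thDiv p q n n' f ∈ (m : ℝ) • symEdgePolytope G := by
  have hm' : (0:ℝ) < m := by exact_mod_cast hm
  have hconv : Convex ℝ (symEdgePolytope G) := convex_convexHull _ _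
  have hplus : ∀ e, thW p q n n' e ∈ symEdgePolytope G := fun e =>
    subset_convexHull _ _ ⟨_, _, hadj e, rfl⟩
  have hminus : ∀ e, - thW p q n n' e ∈ symEdgePolytope G := fun e =>
    subset_convexHull _ _ ⟨_, _, (hadj e).symm, by simp [thW]⟩
  have h0 : (0 : V → ℝ) ∈ symEdgePolytope G := by
    have := hconv (hplus none) (hminus none) (a := 1/2) (b := 1/2) (by norm_num) (by norm_num)
      (by norm_num)
    simpa using this
  let z : Option (Option (Fin n ⊕ Fin n')) → V → ℝ := fun o => o.elim 0
    (fun e => if 0 ≤ f e then thW p q n n' e else - thW p q n n' e)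
  let w : Option (Option (Fin n ⊕ Fin n')) → ℝ := fun o => o.elim (1 - ∑ e, |f e| / m)
    (fun e => |f e| / m)
  have hle : ∑ e, |f e| / m ≤ 1 := by
    rw [← Finset.sum_div, div_le_one hm']; exact hf
  have hmem : ∑ o, w o • z o ∈ symEdgePolytope G := by
    apply hconv.sum_mem
    · rintro (_ | e) _
      · simp only [w, Option.elim]; linarith
      · simp only [w, Option.elim]; positivity
    · rw [Fintype.sum_option]; simp [w]
    · rintro (_ | e) _
      · exact h0
      · simp only [z, Option.elim]
        split_ifs
        · exact hplus e
        · exact hminus e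
  refine ⟨_, hmem, ?_⟩
  rw [Fintype.sum_option]
  simp only [w, z, Option.elim, smul_zero, zero_add, thDiv, Finset.smul_sum]
  refine Finset.sum_congr rfl fun e _ => ?_
  rw [smul_smul, mul_div_cancel₀ _ hm'.ne']
  split_ifs with h
  · rw [abs_of_nonneg h]
  · rw [abs_of_neg (not_le.1 h)]; simp
end

theorem th_core {V : Type*} [DecidableEq V] (G : SimpleGraph V) (i j : ℕ) (hi : 1 ≤ i)
    (hj : 1 ≤ j) (p q : ℕ → V) (h : ThG p q (2 * i) (2 * j))
    (hadj : ∀ u v, G.Adj u v ↔ ∃ e, (thSrc p q (2 * i) (2 * j) e = u ∧ thTgt p q (2 * i) (2 * j) e = v) ∨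
      (thSrc p q (2 * i) (2 * j) e = v ∧ thTgt p q (2 * i) (2 * j) e = u)) :
    Filter.Tendsto
      (fun m : ℕ =>
        (latticePointCount (symEdgePolytope G) m : ℝ) / (m : ℝ) ^ (2 * i + 2 * j - 1))
      Filter.atTop
      (nhds ((((i + j + 2 * i * j) * Nat.choose (2 * i) i * Nat.choose (2 * j) j : ℕ) : ℝ) /
        (Nat.factorial (2 * i + 2 * j - 1) : ℝ))) := by
  rw [← th_cardK]
  refine th_squeeze (E := ThE i j) (K := ThK i j) thS _ (th_supp hi hj)
    (fun m => {x : V → ℝ | x ∈ (m : ℝ) • symEdgePolytope G ∧ ∀ v, ∃ z : ℤ, x v = z})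
    (thDiv p q (2 * i) (2 * j)) ?_ ?_ ?_
  · rintro m x ⟨hx, hz⟩
    obtain ⟨f, hf, rfl⟩ := th_adj_mem (fun u v => (hadj u v).1) hx
    obtain ⟨κ, s, t, r, hstr, hcl, hnorm, hzero⟩ := th_red hi hj (f none)
      (fun k => f (some (.inl k))) (fun k => f (some (.inr k)))
    set f' : ThE i j → ℝ := el3 (f none + s) (fun k => f (some (.inl k)) + t)
      (fun k => f (some (.inr k)) + r) with hf'
    have e1 : f' = fun e => f e + el3 s (fun _ => t) (fun _ => r) e := by
      funext e; rcases e with _ | k | k <;> rfl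
    have e2 : thDiv p q (2 * i) (2 * j) f' = thDiv p q (2 * i) (2 * j) f := by
      rw [e1, thDiv_add, thDiv_shift h hstr, add_zero]
    let S : AddSubgroup ℝ := (Int.castAddHom ℝ).range
    have hS : ∀ v, thDiv p q (2 * i) (2 * j) f' v ∈ S := fun v => by
      obtain ⟨z, hz⟩ := hz v
      exact ⟨z, by rw [e2, hz]; rfl⟩
    obtain ⟨hb, hc, ha⟩ := th_int h S f' hS
    have k0 : Fin (2 * i) := ⟨0, by omega⟩
    have l0 : Fin (2 * j) := ⟨0, by omega⟩
    have hint : ∀ e, f' e ∈ S := by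
      have Bz : (∃ k, f' (some (.inl k)) = 0) → ∀ k, f' (some (.inl k)) ∈ S := by
        rintro ⟨k, hk⟩ l; have := hb l k; rwa [hk, sub_zero] at this
      have Cz : (∃ k, f' (some (.inr k)) = 0) → ∀ k, f' (some (.inr k)) ∈ S := by
        rintro ⟨k, hk⟩ l; have := hc l k; rwa [hk, sub_zero] at this
      have hzero' : ((∃ k, f' (some (.inl k)) = 0) ∧ (∃ k, f' (some (.inr k)) = 0)) ∨
        (f' none = 0 ∧ ((∃ k, f' (some (.inl k)) = 0) ∨ (∃ k, f' (some (.inr k)) = 0))) := hzero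
      rcases hzero' with ⟨z1, z2⟩ | ⟨z0, z1 | z2⟩
      · rintro (_ | k | k)
        · have := S.sub_mem (ha k0 l0) (S.add_mem (Bz z1 k0) (Cz z2 l0))
          simpa using this
        · exact Bz z1 k
        · exact Cz z2 k
      · rintro (_ | k | k)
        · change f' none ∈ S
          rw [z0]; exact S.zero_mem
        · exact Bz z1 k
        · have := S.sub_mem (ha k0 k) (Bz z1 k0)
          simpa [z0] using this
      · rintro (_ | k | k)
        · change f' none ∈ S
          rw [z0]; exact S.zero_mem
        · have := S.sub_mem (ha k l0) (Cz z2 l0)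
          simpa [z0] using this
        · exact Cz z2 k
    choose Z hZ using hint
    have hZ' : ∀ e, (Z e : ℝ) = f' e := hZ
    have hg : ∀ e, (((Z e).natAbs : ℕ) : ℝ) = |f' e| := fun e => by
      rw [Nat.cast_natAbs, Int.cast_abs, hZ']
    refine ⟨κ, fun e => (Z e).natAbs, ?_, ?_, ?_⟩
    · intro e he
      have h1 : f' e = 0 := by rw [hcl e, he, zero_mul]
      have h2 := hg e
      rw [h1, abs_zero] at h2
      exact_mod_cast h2
    · have h1 : ∑ e, |f' e| ≤ (m : ℝ) := by
        rw [Fintype.sum_option, Fintype.sum_sum_type] at hf ⊢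
        exact hnorm.trans hf
      have h2 : ((∑ e, (Z e).natAbs : ℕ) : ℝ) ≤ m := by
        rw [Nat.cast_sum]; simp only [hg]; exact h1
      exact_mod_cast h2
    · rw [← e2]
      congr 1
      funext e
      rw [hg]; exact (hcl e).symm
  · intro m hm κ g hg
    refine ⟨th_mem_adj hm (fun e => (hadj _ _).2 ⟨e, Or.inl ⟨rfl, rfl⟩⟩) ?_, ?_⟩
    · have h2 : ((∑ e, g e : ℕ) : ℝ) ≤ m := by exact_mod_cast hg
      rw [Nat.cast_sum] at h2
      refine le_trans (Finset.sum_le_sum fun e _ => ?_) h2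
      rcases thS_vals κ e with h | h | h <;> simp [h]
    · intro v
      let S : AddSubgroup ℝ := (Int.castAddHom ℝ).range
      suffices hh : thDiv p q (2 * i) (2 * j) (fun e => thS κ e * g e) v ∈ S by
        obtain ⟨z, hz⟩ := hh
        exact ⟨z, hz.symm⟩
      have hone : ∀ u : V, ∃ z : ℤ, (z : ℝ) = (Pi.single u 1 : V → ℝ) v := by
        intro u
        rw [Pi.single_apply]
        split_ifs
        · exact ⟨1, by simp⟩
        · exact ⟨0, by simp⟩
      rw [thDiv, Finset.sum_apply]
      refine S.sum_mem fun e _ => ?_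
      obtain ⟨z1, h1⟩ := hone (thSrc p q (2 * i) (2 * j) e)
      obtain ⟨z2, h2⟩ := hone (thTgt p q (2 * i) (2 * j) e)
      simp only [thW, Pi.smul_apply, Pi.sub_apply, ← h1, ← h2, smul_eq_mul]
      rcases thS_vals κ e with h | h | h <;> rw [h]
      · exact ⟨-1 * g e * (z1 - z2), by simp⟩
      · exact ⟨0, by simp⟩
      · exact ⟨1 * g e * (z1 - z2), by simp⟩
  · intro κ κ' g g' hg hg' hD
    set f : ThE i j → ℝ := fun e => thS κ e * g e with hf
    set f' : ThE i j → ℝ := fun e => thS κ' e * g' e with hf'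
    have hdiff : thDiv p q (2 * i) (2 * j) (fun e => f' e + (-1) * f e) = 0 := by
      rw [thDiv_add, thDiv_smul, hD]; simp
    obtain ⟨hb, hc, ha⟩ := th_int h ⊥ _ (fun v => by rw [hdiff]; exact AddSubgroup.mem_bot.2 rfl)
    simp only [AddSubgroup.mem_bot] at hb hc ha
    let k0 : Fin (2 * i) := ⟨0, by omega⟩
    let l0 : Fin (2 * j) := ⟨0, by omega⟩
    refine th_inj hi hj κ κ' g g' hg hg' (f' none - f none)
      (f' (some (.inl k0)) - f (some (.inl k0))) (f' (some (.inr l0)) - f (some (.inr l0))) ?_ ?_ ?_ ?_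
    · linarith [ha k0 l0]
    · change f' none = f none + _
      ring
    · intro k
      change f' (some (.inl k)) = f (some (.inl k)) + _
      linarith [hb k k0]
    · intro k
      change f' (some (.inr k)) = f (some (.inr k)) + _
      linarith [hc k l0]

/-- Let `G` be the graph obtained by gluing two odd cycles, of
lengths `2i+1` and `2j+1` (given by injective maps `φ`, `ψ`), along a single edge
(with its two endpoints). Then
`lim_{m→∞} #(m·P_G ∩ ℤ^{V(G)}) / m^{2i+2j−1} = (i+j+2ij)·C(2i,i)·C(2j,j)/(2i+2j−1)!`,
i.e. the normalized volume of `P_G` equals `(i+j+2ij)·C(2i,i)·C(2j,j)`. -/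
theorem stmt11 {V : Type*} [Fintype V] [DecidableEq V] (G : SimpleGraph V)
    (i j : ℕ) (hi : 1 ≤ i) (hj : 1 ≤ j)
    (φ : ZMod (2 * i + 1) → V) (ψ : ZMod (2 * j + 1) → V)
    (hφ : Function.Injective φ) (hψ : Function.Injective ψ)
    (hcover : ∀ v : V, (∃ x, φ x = v) ∨ (∃ y, ψ y = v))
    (hadj : ∀ u v : V, G.Adj u v ↔
      ((∃ x, (φ x = u ∧ φ (x + 1) = v) ∨ (φ x = v ∧ φ (x + 1) = u)) ∨
       (∃ y, (ψ y = u ∧ ψ (y + 1) = v) ∨ (ψ y = v ∧ ψ (y + 1) = u))))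
    (hglue : ∃ x y, Set.range φ ∩ Set.range ψ = {φ x, φ (x + 1)} ∧
      ((ψ y = φ x ∧ ψ (y + 1) = φ (x + 1)) ∨ (ψ y = φ (x + 1) ∧ ψ (y + 1) = φ x))) :
    Filter.Tendsto
      (fun m : ℕ =>
        (latticePointCount (symEdgePolytope G) m : ℝ) / (m : ℝ) ^ (2 * i + 2 * j - 1))
      Filter.atTop
      (nhds ((((i + j + 2 * i * j) * Nat.choose (2 * i) i * Nat.choose (2 * j) j : ℕ) : ℝ) /
        (Nat.factorial (2 * i + 2 * j - 1) : ℝ))) := by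
  obtain ⟨x, y, hinter, hxy⟩ := hglue
  -- facts on `ZMod`
  have inj : ∀ N : ℕ, ∀ k l : ℕ, k ≤ N → l ≤ N → ((k : ZMod (N + 1)) = l) → k = l := by
    intro N k l hk hl h
    have := (ZMod.natCast_eq_natCast_iff' k l (N + 1)).1 h
    rwa [Nat.mod_eq_of_lt (by omega), Nat.mod_eq_of_lt (by omega)] at this
  have top : ∀ N : ℕ, ((N : ZMod (N + 1)) + 1 = 0) := by
    intro N
    have := ZMod.natCast_self (N + 1)
    push_cast at this
    exact this
  have surj : ∀ N : ℕ, ∀ z : ZMod (N + 1), ∃ k : ℕ, k ≤ N ∧ (k : ZMod (N + 1)) = z := by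
    intro N z
    exact ⟨z.val, Nat.lt_succ_iff.1 (ZMod.val_lt z), ZMod.natCast_zmod_val z⟩
  let p : ℕ → V := fun k => φ (x + 1 + (k : ZMod (2 * i + 1)))
  have hp0 : p 0 = φ (x + 1) := by simp [p]
  have hpn : p (2 * i) = φ x := by
    have := top (2 * i)
    simp only [p]
    rw [show x + 1 + ((2 * i : ℕ) : ZMod (2 * i + 1)) = x + (((2 * i : ℕ) : ZMod (2 * i + 1)) + 1) by ring,
      this, add_zero]
  have hpinj : ∀ k l, k ≤ 2 * i → l ≤ 2 * i → p k = p l → k = l := fun k l hk hl h =>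
    inj _ k l hk hl (add_left_cancel (hφ h))
  have hpadj : ∀ u v, (∃ z, φ z = u ∧ φ (z + 1) = v) ↔
      ((p (2 * i) = u ∧ p 0 = v) ∨ ∃ k : Fin (2 * i), p k = u ∧ p (k + 1) = v) := by
    intro u v
    constructor
    · rintro ⟨z, rfl, rfl⟩
      obtain ⟨k, hk, hkz⟩ := surj (2 * i) (z - (x + 1))
      rcases hk.lt_or_eq with hk | rfl
      · refine Or.inr ⟨⟨k, hk⟩, ?_, ?_⟩
        · simp only [p, hkz]; congr 1; ring
        · simp only [p]; push_cast; rw [hkz]; congr 1; ring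
      · have hzx : z = x := by
          have h1 := top (2 * i)
          rw [hkz] at h1
          have : z - x = z - (x + 1) + 1 := by ring
          rw [h1] at this
          exact sub_eq_zero.1 this
        rw [hpn, hp0, hzx]; simp
    · rintro (⟨rfl, rfl⟩ | ⟨k, rfl, rfl⟩)
      · exact ⟨x, hpn.symm, hp0.symm⟩
      · exact ⟨x + 1 + ((k : ℕ) : ZMod (2 * i + 1)), rfl, by simp only [p]; push_cast; congr 1; ring⟩
  have main : ∀ q : ℕ → V, (∀ k l, k ≤ 2 * j → l ≤ 2 * j → q k = q l → k = l) →
      q 0 = p 0 → q (2 * j) = p (2 * i) → (∀ k, q k ∈ Set.range ψ) →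
      (∀ u v, (∃ y, (ψ y = u ∧ ψ (y + 1) = v) ∨ (ψ y = v ∧ ψ (y + 1) = u)) ↔
        (((q (2 * j) = u ∧ q 0 = v) ∨ (q (2 * j) = v ∧ q 0 = u)) ∨ ∃ k : Fin (2 * j),
          ((q k = u ∧ q (k + 1) = v) ∨ (q k = v ∧ q (k + 1) = u)))) →
      Filter.Tendsto
      (fun m : ℕ =>
        (latticePointCount (symEdgePolytope G) m : ℝ) / (m : ℝ) ^ (2 * i + 2 * j - 1))
      Filter.atTop
      (nhds ((((i + j + 2 * i * j) * Nat.choose (2 * i) i * Nat.choose (2 * j) j : ℕ) : ℝ) /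
        (Nat.factorial (2 * i + 2 * j - 1) : ℝ))) := by
    intro q hqinj hq0 hqn hqr hqadj
    apply th_core G i j hi hj p q
    · refine ⟨by omega, by omega, hpinj, hqinj, hq0.symm, hqn.symm, ?_⟩
      intro k l hk hl hkl
      have hmem : p k ∈ Set.range φ ∩ Set.range ψ := ⟨⟨_, rfl⟩, hkl ▸ hqr l⟩
      rw [hinter] at hmem
      rcases hmem with h | h
      · rw [← hpn] at h
        refine Or.inr ⟨hpinj _ _ hk le_rfl h, hqinj _ _ hl le_rfl ?_⟩
        rw [← hkl, h, hqn]
      · have h : p k = φ (x + 1) := h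
        rw [← hp0] at h
        refine Or.inl ⟨hpinj _ _ hk (by omega) h, hqinj _ _ hl (by omega) ?_⟩
        rw [← hkl, h, hq0]
    · intro u v
      rw [hadj, hqadj, exists_or, hpadj, hpadj, hqn, hq0]
      constructor
      · rintro (((h | ⟨k, h⟩) | (h | ⟨k, h⟩)) | ((h | h) | ⟨k, h⟩))
        · exact ⟨none, Or.inr ⟨h.2, h.1⟩⟩
        · exact ⟨some (.inl k), Or.inl h⟩
        · exact ⟨none, Or.inl ⟨h.2, h.1⟩⟩
        · exact ⟨some (.inl k), Or.inr h⟩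
        · exact ⟨none, Or.inr ⟨h.2, h.1⟩⟩
        · exact ⟨none, Or.inl ⟨h.2, h.1⟩⟩
        · exact ⟨some (.inr k), h⟩
      · rintro ⟨_ | k | k, h | h⟩
        · exact Or.inl (Or.inr (Or.inl ⟨h.2, h.1⟩))
        · exact Or.inl (Or.inl (Or.inl ⟨h.2, h.1⟩))
        · exact Or.inl (Or.inl (Or.inr ⟨k, h⟩))
        · exact Or.inl (Or.inr (Or.inr ⟨k, h⟩))
        · exact Or.inr (Or.inr ⟨k, Or.inl h⟩)
        · exact Or.inr (Or.inr ⟨k, Or.inr h⟩)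
  rcases hxy with ⟨hy0, hy1⟩ | ⟨hy0, hy1⟩
  · have hqn : ψ (y + 1 + ((2 * j : ℕ) : ZMod (2 * j + 1))) = ψ y := by
      have := top (2 * j)
      rw [show y + 1 + ((2 * j : ℕ) : ZMod (2 * j + 1)) = y + (((2 * j : ℕ) : ZMod (2 * j + 1)) + 1) by ring,
        this, add_zero]
    refine main (fun k => ψ (y + 1 + (k : ZMod (2 * j + 1)))) ?_ ?_ ?_ ?_ ?_
    · exact fun k l hk hl h => inj _ k l hk hl (add_left_cancel (hψ h))
    · simp [hp0, hy1]
    · rw [hqn, hpn, hy0]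
    · exact fun k => ⟨_, rfl⟩
    · intro u v
      simp only [Nat.cast_zero, add_zero]
      rw [hqn]
      constructor
      · rintro ⟨z, hz⟩
        obtain ⟨k, hk, hkz⟩ := surj (2 * j) (z - (y + 1))
        rcases hk.lt_or_eq with hk | rfl
        · refine Or.inr ⟨⟨k, hk⟩, ?_⟩
          have e1 : y + 1 + (k : ZMod (2 * j + 1)) = z := by rw [hkz]; ring
          have e2 : y + 1 + ((k + 1 : ℕ) : ZMod (2 * j + 1)) = z + 1 := by
            push_cast; rw [hkz]; ring
          simp only [e1, e2]; exact hz
        · have hzx : z = y := by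
            have h1 := top (2 * j)
            rw [hkz] at h1
            have : z - y = z - (y + 1) + 1 := by ring
            rw [h1] at this
            exact sub_eq_zero.1 this
          subst hzx
          exact Or.inl hz
      · rintro (h | ⟨k, h⟩)
        · exact ⟨y, h⟩
        · refine ⟨y + 1 + ((k : ℕ) : ZMod (2 * j + 1)), ?_⟩
          rw [show y + 1 + ((k : ℕ) : ZMod (2 * j + 1)) + 1 =
            y + 1 + (((k : ℕ) + 1 : ℕ) : ZMod (2 * j + 1)) by push_cast; ring]
          exact h
  · have hqn : ψ (y - ((2 * j : ℕ) : ZMod (2 * j + 1))) = ψ (y + 1) := by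
      have := top (2 * j)
      rw [show y - ((2 * j : ℕ) : ZMod (2 * j + 1)) =
        y + 1 - (((2 * j : ℕ) : ZMod (2 * j + 1)) + 1) by ring, this, sub_zero]
    refine main (fun k => ψ (y - (k : ZMod (2 * j + 1)))) ?_ ?_ ?_ ?_ ?_
    · exact fun k l hk hl h => inj _ k l hk hl (sub_right_injective (hψ h))
    · simp [hp0, hy0]
    · rw [hqn, hpn, hy1]
    · exact fun k => ⟨_, rfl⟩
    · intro u v
      simp only [Nat.cast_zero, sub_zero]
      rw [hqn]
      constructor
      · rintro ⟨z, hz⟩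
        obtain ⟨k, hk, hkz⟩ := surj (2 * j) (y - (z + 1))
        rcases hk.lt_or_eq with hk | rfl
        · refine Or.inr ⟨⟨k, hk⟩, ?_⟩
          have e1 : y - (k : ZMod (2 * j + 1)) = z + 1 := by rw [hkz]; ring
          have e2 : y - ((k + 1 : ℕ) : ZMod (2 * j + 1)) = z := by
            push_cast; rw [hkz]; ring
          simp only [e1, e2]; tauto
        · have hzx : z = y := by
            have h1 := top (2 * j)
            rw [hkz] at h1
            have : y - z = y - (z + 1) + 1 := by ring
            rw [h1] at this
            exact (sub_eq_zero.1 this).symm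
          subst hzx
          exact Or.inl (by tauto)
      · rintro (h | ⟨k, h⟩)
        · exact ⟨y, by tauto⟩
        · refine ⟨y - (((k : ℕ) + 1 : ℕ) : ZMod (2 * j + 1)), ?_⟩
          rw [show y - (((k : ℕ) + 1 : ℕ) : ZMod (2 * j + 1)) + 1 =
            y - ((k : ℕ) : ZMod (2 * j + 1)) by push_cast; ring]
          tauto
end

section
/- For n ≥ 1 let a_n denote the number of functions w : ℤ/nℤ → {−1, 0, 1} such that there is no i ∈ ℤ/nℤ with {w(i), w(i+1)} = {1, −1} and no i ∈ ℤ/nℤ with w(i) = w(i+1) = w(i+2) = 0. Then for every n ≥ 5 the recursion a_n = 2·a_{n−1} + a_{n−2} − 2·a_{n−4} holds. (For n ≥ 3, a_n is the number of facets of the symmetric edge polytope of the wheel graph K1 * C_n.) -/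
/-- The number of cyclic words `w : ℤ/nℤ → {-1, 0, 1}` avoiding the consecutive
patterns `(1, -1)`, `(-1, 1)` and `(0, 0, 0)` (indices modulo `n`). -/
noncomputable def cyclicWordCount (n : ℕ) : ℕ :=
  Nat.card {w : ZMod n → ℤ //
    (∀ i, w i = -1 ∨ w i = 0 ∨ w i = 1) ∧
    (∀ i, ¬((w i = 1 ∧ w (i + 1) = -1) ∨ (w i = -1 ∧ w (i + 1) = 1))) ∧
    (∀ i, ¬(w i = 0 ∧ w (i + 1) = 0 ∧ w (i + 2) = 0))}

namespace Wheel

abbrev St := Fin 3 × Fin 3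

abbrev R (s t : St) : Prop :=
  s.2 = t.1 ∧ ¬((s.1 = 2 ∧ s.2 = 0) ∨ (s.1 = 0 ∧ s.2 = 2)) ∧
    ¬(s.1 = 1 ∧ s.2 = 1 ∧ t.2 = 1)

def M : Matrix St St ℤ := fun s t => if R s t then 1 else 0

def v (a : Fin 3) : ℤ := (a.val : ℤ) - 1

theorem M_pow : M ^ 5 = 2 * M ^ 4 + M ^ 3 - 2 * M := by
  have h0 : ∀ i j : St, ((M * (M * (M * (M * M)))) i j + (M i j + M i j) : ℤ) =
      (M * (M * (M * M))) i j + (M * (M * (M * M))) i j + (M * (M * M)) i j := by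
    decide +kernel
  have h : M * (M * (M * (M * M))) + (M + M) =
      M * (M * (M * M)) + M * (M * (M * M)) + M * (M * M) := by
    ext i j
    exact h0 i j
  have h1 : M ^ 5 = M * (M * (M * (M * M))) := by noncomm_ring
  rw [h1, eq_sub_of_add_eq h]
  noncomm_ring

theorem pow_apply {S : Type} [Fintype S] [DecidableEq S] (M : Matrix S S ℤ) (n : ℕ) :
    ∀ i j : S, (M ^ (n + 1)) i j =
    ∑ f : Fin (n + 1) → S, if f 0 = i then
      (∏ k : Fin n, M (f k.castSucc) (f k.succ)) * M (f (Fin.last n)) j else 0 := by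
  induction n with
  | zero =>
    intro i j
    rw [← (Equiv.funUnique (Fin 1) S).symm.sum_comp]
    simp
  | succ n ih =>
    intro i j
    rw [pow_succ', Matrix.mul_apply, ← (Fin.consEquiv (fun _ => S)).sum_comp,
      Fintype.sum_prod_type_right]
    simp only [ih, Finset.mul_sum]
    rw [Finset.sum_comm]
    refine Finset.sum_congr rfl fun g _ => ?_
    simp only [Fin.consEquiv_apply, Fin.cons_zero, Fin.prod_univ_succ (n := n),
      ← Fin.succ_last, Fin.cons_succ, Fin.castSucc_zero, ← Fin.succ_castSucc]
    simp [mul_assoc]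

theorem trace_pow (n : ℕ) : (M ^ (n + 1)).trace =
    ∑ f : Fin (n + 1) → St, ∏ k : Fin (n + 1), M (f k) (f (k + 1)) := by
  simp only [Matrix.trace, Matrix.diag, pow_apply]
  rw [Finset.sum_comm]
  refine Finset.sum_congr rfl fun g _ => ?_
  rw [Fin.prod_univ_castSucc]
  simp

theorem v_inj : Function.Injective v := by
  intro a b h
  revert a b
  decide

theorem v_neg (a : Fin 3) : v a = -1 ↔ a = 0 := by revert a; decide
theorem v_zero (a : Fin 3) : v a = 0 ↔ a = 1 := by revert a; decide
theorem v_one (a : Fin 3) : v a = 1 ↔ a = 2 := by revert a; decide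
theorem v_surj (x : ℤ) (h : x = -1 ∨ x = 0 ∨ x = 1) : ∃ a, v a = x := by
  rcases h with rfl | rfl | rfl
  · exact ⟨0, by decide⟩
  · exact ⟨1, by decide⟩
  · exact ⟨2, by decide⟩

theorem count (n : ℕ) : (cyclicWordCount (n + 1) : ℤ) = (M ^ (n + 1)).trace := by
  have key : (M ^ (n + 1)).trace =
    ∑ f : ZMod (n + 1) → St, ∏ k : ZMod (n + 1), M (f k) (f (k + 1)) := trace_pow n
  rw [key]
  simp only [M, Finset.prod_boole, Finset.mem_univ, true_imp_iff, Finset.sum_boole]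
  congr 1
  rw [← Fintype.card_subtype, ← Nat.card_eq_fintype_card, cyclicWordCount]
  symm
  have h2 : ∀ i : ZMod (n + 1), i + 2 = i + 1 + 1 := fun i => by ring
  refine Nat.card_congr (Equiv.ofBijective
    (fun f => ⟨fun i : ZMod (n + 1) => v (f.1 i).1, ?_, ?_, ?_⟩) ⟨?_, ?_⟩)
  · intro i
    have : ∀ a, v a = -1 ∨ v a = 0 ∨ v a = 1 := by decide
    exact this _
  · intro i
    obtain ⟨h, h', -⟩ := f.2 i
    rw [h] at h'
    simp only [v_one, v_neg]
    exact h'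
  · intro i
    obtain ⟨h, -, h'⟩ := f.2 i
    have h3 := (f.2 (i + 1)).1
    rw [h, h3] at h'
    simp only [h2, v_zero]
    exact h'
  · rintro ⟨f, hf⟩ ⟨g, hg⟩ h
    have h' : ∀ i, (f i).1 = (g i).1 := fun i => v_inj (congrFun (congrArg Subtype.val h) i)
    apply Subtype.ext
    funext i
    refine Prod.ext (h' i) ?_
    rw [(hf i).1, (hg i).1]
    exact h' _
  · rintro ⟨w, h0, h1, h3⟩
    choose u hu using fun i => v_surj (w i) (h0 i)
    refine ⟨⟨fun i : ZMod (n + 1) => (u i, u (i + 1)), fun i => ⟨rfl, ?_, ?_⟩⟩, ?_⟩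
    · have := h1 i
      rw [← hu i, ← hu (i + 1)] at this
      simp only [v_one, v_neg] at this
      exact this
    · have := h3 i
      rw [h2, ← hu i, ← hu (i + 1), ← hu (i + 1 + 1)] at this
      simp only [v_zero] at this
      exact this
    · apply Subtype.ext
      funext i
      exact hu i

end Wheel

/-- The counts `a_n` of such cyclic words (which for `n ≥ 3` are the
facet numbers of the symmetric edge polytopes of wheel graphs) satisfy, for `n ≥ 5`,
the recursion `a_n = 2a_{n−1} + a_{n−2} − 2a_{n−4}`. -/
theorem stmt13 (n : ℕ) (hn : 5 ≤ n) :
    (cyclicWordCount n : ℤ) =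
      2 * cyclicWordCount (n - 1) + cyclicWordCount (n - 2) -
        2 * cyclicWordCount (n - 4) := by
  obtain ⟨m, rfl⟩ := Nat.exists_eq_add_of_le' hn
  rw [show m + 5 - 1 = m + 3 + 1 by omega, show m + 5 - 2 = m + 2 + 1 by omega,
    show m + 5 - 4 = m + 1 by omega, show m + 5 = m + 4 + 1 by omega]
  simp only [Wheel.count]
  have h : Wheel.M ^ (m + 4 + 1) = (2 : ℤ) • Wheel.M ^ (m + 3 + 1) + Wheel.M ^ (m + 2 + 1)
      - (2 : ℤ) • Wheel.M ^ (m + 1) := by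
    rw [show m + 4 + 1 = m + 5 by omega, pow_add, Wheel.M_pow]
    noncomm_ring
  rw [h, Matrix.trace_sub, Matrix.trace_add, Matrix.trace_smul, Matrix.trace_smul,
    smul_eq_mul, smul_eq_mul]
end

section
/- For n ≥ 3 let W_n be the set of functions w : ℤ/nℤ → {−1, 0, 1} such that there is no i ∈ ℤ/nℤ with {w(i), w(i+1)} = {1, −1} and no i ∈ ℤ/nℤ with w(i) = w(i+1) = w(i+2) = 0; for w ∈ W_n set c(w) := #{ i ∈ ℤ/nℤ : w(i) ≠ 0, w(i+1) = 0, w(i+2) ≠ 0 }. Then Σ_{w ∈ W_n} 2^{c(w)} = (1−√3)^n + (1+√3)^n + 1 + (−1)^n. -/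
namespace Wheel

/-- local weight; letters `0,1,2` stand for `-1,0,1` -/
def F (a b c : Fin 3) : ℤ :=
  if (a = 2 ∧ b = 0) ∨ (a = 0 ∧ b = 2) then 0
  else if a = 1 ∧ b = 1 ∧ c = 1 then 0
  else if a ≠ 1 ∧ b = 1 ∧ c ≠ 1 then 2 else 1

/-- transfer matrix -/
def T : Matrix (Fin 3 × Fin 3) (Fin 3 × Fin 3) ℤ :=
  fun p q => if p.2 = q.1 then F p.1 p.2 q.2 else 0

/-- explicit powers -/
def P : ℕ → Fin 3 → Fin 3 → Fin 3 → Fin 3 → ℤ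
  | 0, a, b, c, d => if a = c ∧ b = d then 1 else 0
  | k + 1, a, b, c, d =>
      F a b 0 * P k b 0 c d + F a b 1 * P k b 1 c d + F a b 2 * P k b 2 c d

theorem T_pow (k : ℕ) : ∀ a b c d, (T ^ k) (a, b) (c, d) = P k a b c d := by
  induction k with
  | zero => intro a b c d; simp [P, Matrix.one_apply]
  | succ k ih =>
    intro a b c d
    rw [pow_succ', Matrix.mul_apply, Fintype.sum_prod_type]
    simp only [T, P, ih, ite_mul, zero_mul]
    rw [Finset.sum_eq_single b]
    · simp [Fin.sum_univ_three]
    · intro x _ hx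
      simp [Ne.symm hx]
    · simp

theorem P_rec : ∀ a b c d, P 5 a b c d =
    2 * P 4 a b c d + 3 * P 3 a b c d - 2 * P 2 a b c d - 2 * P 1 a b c d := by
  decide +kernel

theorem T_rec : T ^ 5 = (2:ℤ) • T ^ 4 + (3:ℤ) • T ^ 3 - (2:ℤ) • T ^ 2 - (2:ℤ) • T ^ 1 := by
  ext ⟨a, b⟩ ⟨c, d⟩
  have := P_rec a b c d
  simp only [Matrix.sub_apply, Matrix.add_apply, Matrix.smul_apply, T_pow, smul_eq_mul]
  exact this

theorem trace_rec (k : ℕ) : (T ^ (k + 5)).trace = 2 * (T ^ (k + 4)).trace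
    + 3 * (T ^ (k + 3)).trace - 2 * (T ^ (k + 2)).trace - 2 * (T ^ (k + 1)).trace := by
  have : T ^ (k + 5) = (2:ℤ) • T ^ (k + 4) + (3:ℤ) • T ^ (k + 3) - (2:ℤ) • T ^ (k + 2) - (2:ℤ) • T ^ (k + 1) := by
    simp only [pow_add T k, T_rec, mul_add, mul_sub, mul_smul_comm]
  rw [this]
  simp only [Matrix.trace_add, Matrix.trace_sub, Matrix.trace_smul, smul_eq_mul]

theorem trace_P (k : ℕ) : (T ^ k).trace = ∑ a, ∑ b, P k a b a b := by
  simp [Matrix.trace, Fintype.sum_prod_type, T_pow]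

theorem trace_formula (k : ℕ) : ((T ^ (k + 1)).trace : ℝ) =
    (1 - Real.sqrt 3) ^ (k + 1) + (1 + Real.sqrt 3) ^ (k + 1) + 1 + (-1 : ℝ) ^ (k + 1) := by
  have h3 : Real.sqrt 3 ^ 2 = 3 := Real.sq_sqrt (by norm_num)
  induction k using Nat.strong_induction_on with
  | _ k ih =>
    match k, ih with
    | 0, _ =>
      have : (T ^ 1).trace = 2 := by rw [trace_P]; decide +kernel
      rw [this]; push_cast; ring
    | 1, _ =>
      have : (T ^ 2).trace = 10 := by rw [trace_P]; decide +kernel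
      rw [this]; push_cast; linear_combination (-2) * h3
    | 2, _ =>
      have : (T ^ 3).trace = 20 := by rw [trace_P]; decide +kernel
      rw [this]; push_cast; linear_combination (-6) * h3
    | 3, _ =>
      have : (T ^ 4).trace = 58 := by rw [trace_P]; decide +kernel
      rw [this]; push_cast; linear_combination (-2 * Real.sqrt 3 ^ 2 - 18) * h3
    | k + 4, ih =>
      have e1 := ih k (by omega)
      have e2 := ih (k + 1) (by omega)
      have e3 := ih (k + 2) (by omega)
      have e4 := ih (k + 3) (by omega)
      rw [trace_rec]
      push_cast
      rw [e1, e2, e3, e4]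
      have ha : ∀ x : ℝ, x ^ 4 = 2 * x ^ 3 + 3 * x ^ 2 - 2 * x - 2 → x ^ (k + 4 + 1) =
          2 * x ^ (k + 3 + 1) + 3 * x ^ (k + 2 + 1) - 2 * x ^ (k + 1 + 1) - 2 * x ^ (k + 1) := by
        intro x hx
        linear_combination x ^ (k + 1) * hx
      have hm := ha (1 - Real.sqrt 3)
        (by linear_combination (Real.sqrt 3 ^ 2 - 2 * Real.sqrt 3) * h3)
      have hp := ha (1 + Real.sqrt 3)
        (by linear_combination (Real.sqrt 3 ^ 2 + 2 * Real.sqrt 3) * h3)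
      have hn := ha (-1) (by norm_num)
      rw [hm, hp, hn]
      ring

theorem pow_path {S : Type*} [Fintype S] [DecidableEq S] (M : Matrix S S ℤ) (k : ℕ) :
    ∀ a b, (M ^ (k + 1)) a b = ∑ s : Fin k → S,
      ∏ i : Fin (k + 1), M ((Fin.cons a s : Fin (k + 1) → S) i)
        ((Fin.snoc s b : Fin (k + 1) → S) i) := by
  induction k with
  | zero => intro a b; simp [Fin.snoc]
  | succ k ih =>
    intro a b
    rw [pow_succ', Matrix.mul_apply, ← (Fin.consEquiv (fun _ => S)).sum_comp,
      Fintype.sum_prod_type]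
    refine Finset.sum_congr rfl fun c _ => ?_
    rw [ih, Finset.mul_sum]
    refine Finset.sum_congr rfl fun t _ => ?_
    rw [Fin.prod_univ_succ (n := k + 1)]
    simp [Fin.consEquiv, ← Fin.cons_snoc_eq_snoc_cons]

theorem trace_path {S : Type*} [Fintype S] [DecidableEq S] (M : Matrix S S ℤ) (k : ℕ) :
    (M ^ (k + 1)).trace = ∑ s : Fin (k + 1) → S, ∏ i, M (s i) (s (i + 1)) := by
  rw [Matrix.trace, ← (Fin.consEquiv (fun _ => S)).sum_comp, Fintype.sum_prod_type]
  refine Finset.sum_congr rfl fun a _ => ?_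
  rw [Matrix.diag_apply, pow_path]
  refine Finset.sum_congr rfl fun t _ => ?_
  refine Finset.prod_congr rfl fun i _ => ?_
  congr 1
  induction i using Fin.lastCases with
  | last => simp [Fin.consEquiv]
  | cast j => simp [Fin.consEquiv, Fin.coeSucc_eq_succ]

theorem trace_words (k : ℕ) :
    (T ^ (k + 1)).trace =
      ∑ v : Fin (k + 1) → Fin 3, ∏ i, F (v i) (v (i + 1)) (v (i + 1 + 1)) := by
  rw [trace_path]
  symm
  refine Finset.sum_of_injOn (fun v i => (v i, v (i + 1))) ?_ ?_ ?_ ?_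
  · intro v _ v' _ h
    funext i
    exact congrArg Prod.fst (congrFun h i)
  · intro v _; simp
  · intro s _ hs
    by_contra h
    apply hs
    rw [← ne_eq, Finset.prod_ne_zero_iff] at h
    refine ⟨fun i => (s i).1, by simp, ?_⟩
    funext i
    have hi := h i (Finset.mem_univ _)
    have : (s i).2 = (s (i + 1)).1 := by
      by_contra h'
      exact hi (by simp [T, h'])
    exact Prod.ext rfl this.symm
  · intro v _
    simp [T]

/-- decoding of letters -/
def e (a : Fin 3) : ℤ := (a : ℤ) - 1

theorem F_zero : ∀ a b c, ((e a = 1 ∧ e b = -1) ∨ (e a = -1 ∧ e b = 1)) ∨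
    (e a = 0 ∧ e b = 0 ∧ e c = 0) → F a b c = 0 := by decide

theorem F_ne : ∀ a b c, ¬ ((e a = 1 ∧ e b = -1) ∨ (e a = -1 ∧ e b = 1)) →
    ¬ (e a = 0 ∧ e b = 0 ∧ e c = 0) →
    F a b c = if e a ≠ 0 ∧ e b = 0 ∧ e c ≠ 0 then 2 else 1 := by decide

theorem e_inj : Function.Injective e := by decide

theorem e_surj (x : ℤ) (h : x = -1 ∨ x = 0 ∨ x = 1) : ∃ a, e a = x := by
  rcases h with rfl | rfl | rfl
  exacts [⟨0, rfl⟩, ⟨1, rfl⟩, ⟨2, rfl⟩]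

theorem e_mem : ∀ a, e a = -1 ∨ e a = 0 ∨ e a = 1 := by decide

end Wheel

open Wheel in
/-- For `n ≥ 3`, let `W_n` be the set of cyclic words
`w : ℤ/nℤ → {-1, 0, 1}` avoiding the consecutive patterns `(1, -1)`, `(-1, 1)` and
`(0, 0, 0)`, and for `w ∈ W_n` let `c(w)` be the number of `i` with `w i ≠ 0`,
`w (i+1) = 0`, `w (i+2) ≠ 0`. Then
`∑_{w ∈ W_n} 2^{c(w)} = (1−√3)^n + (1+√3)^n + 1 + (−1)^n`. -/
theorem stmt14 (n : ℕ) (hn : 3 ≤ n) :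
    ∑ᶠ w ∈ {w : ZMod n → ℤ |
        (∀ i, w i = -1 ∨ w i = 0 ∨ w i = 1) ∧
        (∀ i, ¬((w i = 1 ∧ w (i + 1) = -1) ∨ (w i = -1 ∧ w (i + 1) = 1))) ∧
        (∀ i, ¬(w i = 0 ∧ w (i + 1) = 0 ∧ w (i + 2) = 0))},
      (2 : ℝ) ^ (Nat.card {i : ZMod n // w i ≠ 0 ∧ w (i + 1) = 0 ∧ w (i + 2) ≠ 0}) =
    (1 - Real.sqrt 3) ^ n + (1 + Real.sqrt 3) ^ n + 1 + (-1 : ℝ) ^ n := by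
  classical
  obtain ⟨k, rfl⟩ : ∃ k, n = k + 1 := ⟨n - 1, by omega⟩
  rw [← trace_formula, trace_words]
  have key : ((∑ v : Fin (k + 1) → Fin 3, ∏ i, F (v i) (v (i + 1)) (v (i + 1 + 1)) : ℤ) : ℝ) =
    ∑ v : ZMod (k + 1) → Fin 3, ((∏ i, F (v i) (v (i + 1)) (v (i + 1 + 1)) : ℤ) : ℝ) :=
    Int.cast_sum _ _
  rw [key]
  set A := {w : ZMod (k + 1) → ℤ |
        (∀ i, w i = -1 ∨ w i = 0 ∨ w i = 1) ∧
        (∀ i, ¬((w i = 1 ∧ w (i + 1) = -1) ∨ (w i = -1 ∧ w (i + 1) = 1))) ∧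
        (∀ i, ¬(w i = 0 ∧ w (i + 1) = 0 ∧ w (i + 2) = 0))} with hA
  have two : ∀ i : ZMod (k + 1), i + 1 + 1 = i + 2 := fun i => by ring
  rw [← finsum_mem_eq_of_bijOn (s := {v : ZMod (k + 1) → Fin 3 | e ∘ v ∈ A}) (t := A)
    (f := fun v => ((∏ i, F (v i) (v (i + 1)) (v (i + 1 + 1)) : ℤ) : ℝ)) (fun v => e ∘ v)]
  · rw [finsum_mem_def, finsum_eq_sum_of_fintype]
    refine Finset.sum_congr rfl fun v _ => ?_
    by_cases h : e ∘ v ∈ A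
    · simp [Set.indicator, h]
    · rw [Set.indicator_of_notMem (by exact h)]
      symm
      have : ∃ i, F (v i) (v (i + 1)) (v (i + 1 + 1)) = 0 := by
        by_contra h'
        push Not at h'
        refine h ⟨fun i => e_mem _, fun i hi => h' i (F_zero _ _ _ (Or.inl hi)), fun i hi =>
          h' i (F_zero _ _ _ (Or.inr ?_))⟩
        rw [two]; exact hi
      obtain ⟨i, hi⟩ := this
      rw [Finset.prod_eq_zero (Finset.mem_univ i) hi, Int.cast_zero]
  · refine ⟨fun v hv => hv, fun v _ v' _ h => ?_, fun w hw => ?_⟩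
    · funext i
      exact e_inj (congrFun h i)
    · choose v hv using fun i => e_surj (w i) (hw.1 i)
      have : e ∘ v = w := funext hv
      exact ⟨v, by simpa [this] using hw, this⟩
  · intro v hv
    have : ∀ i, F (v i) (v (i + 1)) (v (i + 1 + 1)) =
        if (e ∘ v) i ≠ 0 ∧ (e ∘ v) (i + 1) = 0 ∧ (e ∘ v) (i + 2) ≠ 0 then 2 else 1 := by
      intro i
      rw [two]
      exact F_ne _ _ _ (hv.2.1 i) (hv.2.2 i)
    simp only [this]
    rw [Finset.prod_ite, Finset.prod_const, Finset.prod_const_one, Nat.card_eq_fintype_card,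
      Fintype.card_subtype]
    push_cast
    ring
end
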